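/- arXiv:1707.08096 — 7 statements merged into one kernel-verified Lean document; each statement's English description precedes it below -/
import Mathlib

section
/- Let N ∈ ℕ, let g : ℝⁿ → ℂ be smooth with compact support such that all partial derivatives of g of every order ≤ N (including g itself) vanish at the origin, and let Q be a nondegenerate real symmetric n×n matrix. Then, as k → +∞, ∫_{ℝⁿ} g(x) e^{i k Q(x,x)} dx = O(k^{-n/2 - ⌊(N+2)/2⌋}). -/
open MeasureTheory Filter Asymptotics

noncomputable section

/-- The quadratic form `Q(x,x) = Σ_{i,j} Q_{ij} x_i x_j` of a real `n×n` matrix. -/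
def quadForm (n : ℕ) (Q : Matrix (Fin n) (Fin n) ℝ) (x : Fin n → ℝ) : ℝ :=
  ∑ i : Fin n, ∑ j : Fin n, Q i j * x i * x j

open Complex Topology Set

variable {ι : Type*} [Fintype ι]

/-- A smooth compactly supported function on `ℝ^ι` is the inverse Fourier transform of an
integrable function. -/
theorem exists_integrable_fourier_repr {g : (ι → ℝ) → ℂ} (hg : ContDiff ℝ (⊤ : ℕ∞) g)
    (hgsupp : HasCompactSupport g) :
    ∃ G : (ι → ℝ) → ℂ, Integrable G ∧
      ∀ x, g x = ∫ ξ, G ξ * cexp (∑ i, 2 * Real.pi * I * ξ i * x i) := by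
  set e := EuclideanSpace.equiv ι ℝ
  have hsm : ContDiff ℝ (⊤ : ℕ∞) (g ∘ e) := hg.comp e.contDiff
  have hc : HasCompactSupport (g ∘ e) := hgsupp.comp_homeomorph e.toHomeomorph
  set f := hc.toSchwartzMap hsm
  refine ⟨fun ξ => (FourierTransform.fourier f) (WithLp.toLp 2 ξ), ?_, fun x => ?_⟩
  · exact ((PiLp.volume_preserving_toLp ι).integrable_comp_emb
      (MeasurableEquiv.toLp 2 (ι → ℝ)).measurableEmbedding).2
      (FourierTransform.fourier f).integrable
  · have h1 : f (WithLp.toLp 2 x) = g x := rfl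
    have h2 := congrArg (fun F => F (WithLp.toLp 2 x))
      (FourierTransform.fourierInv_fourier_eq (F := SchwartzMap (EuclideanSpace ℝ ι) ℂ) f)
    simp only [SchwartzMap.fourierInv_coe] at h2
    rw [← h1, ← h2, Real.fourierInv_eq',
      ← (PiLp.volume_preserving_toLp ι).integral_comp
        (MeasurableEquiv.toLp 2 (ι → ℝ)).measurableEmbedding]
    congr 1 with ξ
    rw [smul_eq_mul, mul_comm]
    congr 2
    simp only [PiLp.inner_apply]
    push_cast
    rw [Finset.mul_sum, Finset.sum_mul]
    refine Finset.sum_congr rfl fun i _ => ?_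
    simp
    ring

theorem integral_mul_cexp_neg_sum_sq {b : ι → ℂ} (hb : ∀ i, 0 < (b i).re)
    {g G : (ι → ℝ) → ℂ} (hG : Integrable G)
    (hgG : ∀ x, g x = ∫ ξ, G ξ * cexp (∑ i, 2 * Real.pi * I * ξ i * x i)) :
    ∫ x, g x * cexp (-∑ i, b i * (x i : ℂ) ^ 2) =
      (∏ i, (Real.pi / b i) ^ (1 / 2 : ℂ)) *
        ∫ ξ, G ξ * cexp (-∑ i, Real.pi ^ 2 * (ξ i : ℂ) ^ 2 / b i) := by
  have hgauss : Integrable fun x : ι → ℝ => cexp (-∑ i, b i * (x i : ℂ) ^ 2) := by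
    simpa using GaussianFourier.integrable_cexp_neg_sum_mul_add hb 0
  have hint : Integrable (Function.uncurry fun (x ξ : ι → ℝ) =>
      G ξ * cexp (∑ i, 2 * Real.pi * I * ξ i * x i) * cexp (-∑ i, b i * (x i : ℂ) ^ 2))
      (volume.prod volume) := by
    have h := (hgauss.mul_prod hG).bdd_mul (c := 1)
      (f := fun p : (ι → ℝ) × (ι → ℝ) => cexp (∑ i, 2 * Real.pi * I * p.2 i * p.1 i))
      (by apply Continuous.aestronglyMeasurable; fun_prop)
      (ae_of_all _ fun p => by
        rw [Complex.norm_exp]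
        simp [Complex.re_sum])
    refine h.congr (ae_of_all _ fun p => ?_)
    simp only [Function.uncurry]
    ring
  simp_rw [hgG, ← integral_mul_const]
  rw [integral_integral_swap hint, ← integral_const_mul]
  congr 1 with ξ
  simp_rw [mul_assoc, integral_const_mul]
  have := GaussianFourier.integral_cexp_neg_sum_mul_add hb (fun i => 2 * Real.pi * I * ξ i)
  rw [Finset.prod_mul_distrib, ← Complex.exp_sum] at this
  simp_rw [← Complex.exp_add]
  rw [← mul_left_comm]
  congr 1
  refine Eq.trans (integral_congr_ae (ae_of_all _ fun x => ?_)) (this.trans ?_)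
  · simp only [mul_assoc, add_comm]
  · congr 2
    rw [← Finset.sum_neg_distrib]
    refine Finset.sum_congr rfl fun i _ => ?_
    have : b i ≠ 0 := fun h => by simpa [h] using hb i
    field_simp
    rw [I_sq]
    ring

/-- The oscillatory integral `∫ g(x) exp(i k ∑ lam_i x_i²) dx` with diagonal quadratic phase. -/
def oscIntegral (lam : ι → ℝ) (g : (ι → ℝ) → ℂ) (k : ℝ) : ℂ :=
  ∫ x, g x * cexp (I * k * ((∑ i, lam i * x i ^ 2 : ℝ) : ℂ))

theorem oscIntegral_eq_fourier {lam : ι → ℝ} (hlam : ∀ i, lam i ≠ 0)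
    {g G : (ι → ℝ) → ℂ} (hgint : Integrable g) (hG : Integrable G)
    (hgG : ∀ x, g x = ∫ ξ, G ξ * cexp (∑ i, 2 * Real.pi * I * ξ i * x i))
    {k : ℝ} (hk : 0 < k) :
    oscIntegral lam g k = (∏ i, (Real.pi / (-(I * k * lam i))) ^ (1 / 2 : ℂ)) *
        ∫ ξ, G ξ * cexp (-∑ i, Real.pi ^ 2 * (ξ i : ℂ) ^ 2 / (-(I * k * lam i))) := by
  have hne : ∀ i, -(I * k * lam i) ≠ 0 := fun i => by
    simp [hk.ne', hlam i]
  have hb : ∀ i, Tendsto (fun ε : ℝ => (ε : ℂ) - I * k * lam i) (𝓝[>] 0)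
      (𝓝 (-(I * k * lam i))) := fun i => by
    have : Continuous fun ε : ℝ => (ε : ℂ) - I * k * lam i := by fun_prop
    simpa using (this.tendsto 0).mono_left nhdsWithin_le_nhds
  have hpos : ∀ᶠ ε : ℝ in 𝓝[>] 0, 0 < ε := self_mem_nhdsWithin
  have hleft : Tendsto (fun ε : ℝ =>
      ∫ x, g x * cexp (-∑ i, ((ε : ℂ) - I * k * lam i) * (x i : ℂ) ^ 2)) (𝓝[>] 0)
      (𝓝 (oscIntegral lam g k)) := by
    refine tendsto_integral_filter_of_dominated_convergence (fun x => ‖g x‖) ?_ ?_ hgint.norm ?_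
    · refine Eventually.of_forall fun ε => hgint.1.mul ?_
      apply Continuous.aestronglyMeasurable
      fun_prop
    · filter_upwards [hpos] with ε hε
      refine ae_of_all _ fun x => ?_
      rw [norm_mul, Complex.norm_exp]
      refine mul_le_of_le_one_right (norm_nonneg _) (Real.exp_le_one_iff.2 ?_)
      rw [Complex.neg_re, Complex.re_sum, neg_nonpos]
      refine Finset.sum_nonneg fun i _ => ?_
      rw [← Complex.ofReal_pow, Complex.re_mul_ofReal]
      simp
      positivity
    · refine ae_of_all _ fun x => Tendsto.const_mul _ ?_
      refine (Complex.continuous_exp.tendsto _).comp ?_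
      have : (I * k * ((∑ i, lam i * x i ^ 2 : ℝ) : ℂ)) =
          -∑ i, -(I * k * lam i) * (x i : ℂ) ^ 2 := by
        push_cast
        rw [Finset.mul_sum, ← Finset.sum_neg_distrib]
        refine Finset.sum_congr rfl fun i _ => ?_
        ring
      rw [this]
      exact (tendsto_finsetSum _ fun i _ => (hb i).mul_const _).neg
  have hright : Tendsto (fun ε : ℝ =>
      (∏ i, (Real.pi / ((ε : ℂ) - I * k * lam i)) ^ (1 / 2 : ℂ)) *
        ∫ ξ, G ξ * cexp (-∑ i, Real.pi ^ 2 * (ξ i : ℂ) ^ 2 / ((ε : ℂ) - I * k * lam i)))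
      (𝓝[>] 0) (𝓝 ((∏ i, (Real.pi / (-(I * k * lam i))) ^ (1 / 2 : ℂ)) *
        ∫ ξ, G ξ * cexp (-∑ i, Real.pi ^ 2 * (ξ i : ℂ) ^ 2 / (-(I * k * lam i))))) := by
    refine Tendsto.mul (tendsto_finsetProd _ fun i _ => ?_) ?_
    · refine ((continuousAt_cpow_const ?_).tendsto).comp (tendsto_const_nhds.div (hb i) (hne i))
      refine Or.inr ?_
      simp only [Complex.div_im]
      simp [hk.ne', hlam i, Real.pi_ne_zero]
    · refine tendsto_integral_filter_of_dominated_convergence (fun x => ‖G x‖) ?_ ?_ hG.norm ?_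
      · refine Eventually.of_forall fun ε => hG.1.mul ?_
        apply Continuous.aestronglyMeasurable
        fun_prop
      · filter_upwards [hpos] with ε hε
        refine ae_of_all _ fun x => ?_
        rw [norm_mul, Complex.norm_exp]
        refine mul_le_of_le_one_right (norm_nonneg _) (Real.exp_le_one_iff.2 ?_)
        rw [Complex.neg_re, Complex.re_sum, neg_nonpos]
        refine Finset.sum_nonneg fun i _ => ?_
        rw [← Complex.ofReal_pow, ← Complex.ofReal_pow, ← Complex.ofReal_mul, div_eq_mul_inv,
          Complex.re_ofReal_mul, Complex.inv_re]
        have := Complex.normSq_nonneg ((ε : ℂ) - I * k * lam i)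
        refine mul_nonneg (by positivity) (div_nonneg ?_ this)
        simp [hε.le]
      · refine ae_of_all _ fun x => Tendsto.const_mul _ ?_
        refine (Complex.continuous_exp.tendsto _).comp ?_
        exact (tendsto_finsetSum _ fun i _ => tendsto_const_nhds.div (hb i) (hne i)).neg
  refine tendsto_nhds_unique hleft (hright.congr' ?_)
  filter_upwards [hpos] with ε hε
  exact (integral_mul_cexp_neg_sum_sq (fun i => by simpa using hε) hG hgG).symm

/-- Leading-order stationary phase, in norm. -/
theorem tendsto_norm_oscIntegral {lam : ι → ℝ} (hlam : ∀ i, lam i ≠ 0)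
    {g : (ι → ℝ) → ℂ} (hg : ContDiff ℝ (⊤ : ℕ∞) g) (hgsupp : HasCompactSupport g) :
    Tendsto (fun k : ℝ => k ^ ((Fintype.card ι : ℝ) / 2) * ‖oscIntegral lam g k‖) atTop
      (𝓝 ((∏ i, (Real.pi / |lam i|) ^ (1 / 2 : ℝ)) * ‖g 0‖)) := by
  obtain ⟨G, hG, hgG⟩ := exists_integrable_fourier_repr hg hgsupp
  have hg0 : g 0 = ∫ ξ, G ξ := by simpa using hgG 0
  have hlim : Tendsto (fun k : ℝ => ∫ ξ, G ξ *
      cexp (-∑ i, Real.pi ^ 2 * (ξ i : ℂ) ^ 2 / (-(I * k * lam i)))) atTop (𝓝 (g 0)) := by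
    rw [hg0]
    refine tendsto_integral_filter_of_dominated_convergence (fun x => ‖G x‖) ?_ ?_ hG.norm ?_
    · refine Eventually.of_forall fun k => hG.1.mul ?_
      apply Continuous.aestronglyMeasurable
      fun_prop
    · refine Eventually.of_forall fun k => ae_of_all _ fun x => ?_
      rw [norm_mul, Complex.norm_exp]
      refine mul_le_of_le_one_right (norm_nonneg _) (Real.exp_le_one_iff.2 (le_of_eq ?_))
      rw [Complex.neg_re, Complex.re_sum, neg_eq_zero]
      refine Finset.sum_eq_zero fun i _ => ?_
      rw [← Complex.ofReal_pow, ← Complex.ofReal_pow, ← Complex.ofReal_mul, div_eq_mul_inv,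
        Complex.re_ofReal_mul, Complex.inv_re]
      simp
    · refine ae_of_all _ fun x => ?_
      have h : Tendsto (fun k : ℝ => cexp (((k⁻¹ : ℝ) : ℂ) *
          (-∑ i, Real.pi ^ 2 * (x i : ℂ) ^ 2 / (-(I * lam i))))) atTop (𝓝 1) := by
        have hc : Continuous fun t : ℝ => cexp ((t : ℂ) *
          (-∑ i, Real.pi ^ 2 * (x i : ℂ) ^ 2 / (-(I * lam i)))) := by fun_prop
        simpa [Function.comp_def] using (hc.tendsto 0).comp tendsto_inv_atTop_zero
      have h' := h.const_mul (G x)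
      rw [mul_one] at h'
      refine h'.congr fun k => ?_
      congr 2
      rw [mul_neg, Finset.mul_sum]
      congr 1
      refine Finset.sum_congr rfl fun i _ => ?_
      push_cast
      rw [mul_right_comm I, ← neg_mul, div_mul_eq_div_div_swap]
      ring
  refine (hlim.norm.const_mul _).congr' ?_
  filter_upwards [eventually_gt_atTop 0] with k hk
  rw [oscIntegral_eq_fourier hlam (hg.continuous.integrable_of_hasCompactSupport hgsupp) hG hgG hk,
    norm_mul, ← mul_assoc, norm_prod]
  congr 1
  have hprod : k ^ ((Fintype.card ι : ℝ) / 2) = ∏ _i : ι, k ^ (1 / 2 : ℝ) := by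
    rw [Finset.prod_const, ← Real.rpow_natCast, ← Real.rpow_mul hk.le, Finset.card_univ]
    congr 1
    ring
  rw [hprod, ← Finset.prod_mul_distrib]
  refine Finset.prod_congr rfl fun i _ => ?_
  have h2 : (1 / 2 : ℂ) = ((1 / 2 : ℝ) : ℂ) := by push_cast; rfl
  rw [h2, Complex.norm_cpow_real, ← Real.mul_rpow hk.le (norm_nonneg _)]
  congr 1
  simp only [norm_div, norm_neg, norm_mul, norm_I, one_mul, norm_real, Real.norm_eq_abs,
    abs_of_pos hk, abs_of_pos Real.pi_pos]
  field_simp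

theorem integrable_mul_cexp_phase {lam : ι → ℝ} {g : (ι → ℝ) → ℂ} (hg : Continuous g)
    (hgsupp : HasCompactSupport g) (k : ℝ) :
    Integrable fun x => g x * cexp (I * k * ((∑ i, lam i * x i ^ 2 : ℝ) : ℂ)) := by
  refine Continuous.integrable_of_hasCompactSupport (by fun_prop) ?_
  exact hgsupp.mul_right

/-- The partial derivative in the `j`-th coordinate direction. -/
def coordDeriv [DecidableEq ι] (j : ι) (g : (ι → ℝ) → ℂ) (x : ι → ℝ) : ℂ :=
  fderiv ℝ g x (Pi.single j 1)

/-- The constant-coefficient operator `∑ lam_j⁻¹ ∂_j²`, dual to the form `∑ lam_j x_j²`. -/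
def dualLaplacian [DecidableEq ι] (lam : ι → ℝ) (g : (ι → ℝ) → ℂ) (x : ι → ℝ) : ℂ :=
  ∑ j, ((lam j)⁻¹ : ℂ) * coordDeriv j (coordDeriv j g) x

section Derivatives

variable [DecidableEq ι] {lam : ι → ℝ} {g : (ι → ℝ) → ℂ}

theorem contDiff_coordDeriv (hg : ContDiff ℝ (⊤ : ℕ∞) g) (j : ι) :
    ContDiff ℝ (⊤ : ℕ∞) (coordDeriv j g) :=
  (hg.fderiv_right (m := (⊤ : ℕ∞)) (by simp)).clm_apply contDiff_const

theorem hasCompactSupport_coordDeriv {κ : Type*} [DecidableEq κ] {g : (κ → ℝ) → ℂ}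
    (hgsupp : HasCompactSupport g) (j : κ) :
    HasCompactSupport (coordDeriv j g) :=
  hgsupp.fderiv_apply ℝ _

theorem contDiff_dualLaplacian (hg : ContDiff ℝ (⊤ : ℕ∞) g) :
    ContDiff ℝ (⊤ : ℕ∞) (dualLaplacian lam g) :=
  ContDiff.sum fun j _ => contDiff_const.mul (contDiff_coordDeriv (contDiff_coordDeriv hg j) j)

theorem hasCompactSupport_dualLaplacian (hgsupp : HasCompactSupport g) :
    HasCompactSupport (dualLaplacian lam g) := by
  refine hgsupp.mono' fun x hx => ?_
  by_contra hx'
  refine hx (Finset.sum_eq_zero fun j _ => ?_)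
  have h : x ∉ tsupport (coordDeriv j g) := fun h => hx' (tsupport_fderiv_apply_subset ℝ _ h)
  have h' : x ∉ tsupport (coordDeriv j (coordDeriv j g)) :=
    fun h'' => h (tsupport_fderiv_apply_subset ℝ _ h'')
  rw [image_eq_zero_of_notMem_tsupport h', mul_zero]

theorem iteratedFDeriv_coordDeriv_eq_zero (hg : ContDiff ℝ (⊤ : ℕ∞) g) {N : ℕ} {x : ι → ℝ}
    (hjet : ∀ m ≤ N + 1, iteratedFDeriv ℝ m g x = 0) (j : ι) :
    ∀ m ≤ N, iteratedFDeriv ℝ m (coordDeriv j g) x = 0 := by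
  intro m hm
  have h := norm_iteratedFDeriv_clm_apply_const (𝕜 := ℝ) (f := fderiv ℝ g)
    (c := (Pi.single j 1 : ι → ℝ)) (x := x) (n := m) (N := (⊤ : ℕ∞))
    ((hg.fderiv_right (m := (⊤ : ℕ∞)) (by simp)).contDiffAt) (by exact_mod_cast le_top)
  rw [norm_iteratedFDeriv_fderiv, hjet (m + 1) (by omega), norm_zero, mul_zero] at h
  exact norm_le_zero_iff.1 h

theorem iteratedFDeriv_dualLaplacian_eq_zero (hg : ContDiff ℝ (⊤ : ℕ∞) g) {N : ℕ} {x : ι → ℝ}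
    (hjet : ∀ m ≤ N + 2, iteratedFDeriv ℝ m g x = 0) :
    ∀ m ≤ N, iteratedFDeriv ℝ m (dualLaplacian lam g) x = 0 := by
  intro m hm
  have hsm (j : ι) : ContDiff ℝ m (coordDeriv j (coordDeriv j g)) :=
    (contDiff_coordDeriv (contDiff_coordDeriv hg j) j).of_le (by exact_mod_cast le_top)
  have hL : dualLaplacian lam g =
      fun y => ∑ j, (((lam j)⁻¹ : ℂ) • coordDeriv j (coordDeriv j g)) y := by
    funext y
    simp [dualLaplacian]
  rw [hL, iteratedFDeriv_sum (f := fun j => ((lam j)⁻¹ : ℂ) • coordDeriv j (coordDeriv j g))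
    (fun j _ => contDiff_const.smul (hsm j)), Finset.sum_apply]
  refine Finset.sum_eq_zero fun j _ => ?_
  rw [iteratedFDeriv_const_smul_apply (hsm j).contDiffAt,
    iteratedFDeriv_coordDeriv_eq_zero (contDiff_coordDeriv hg j)
      (iteratedFDeriv_coordDeriv_eq_zero hg hjet j) j m hm, smul_zero]

theorem oscIntegral_coordDeriv (hg : ContDiff ℝ (⊤ : ℕ∞) g) (hgsupp : HasCompactSupport g)
    (k : ℝ) (j : ι) :
    oscIntegral lam (coordDeriv j g) k =
      -(2 * I * k * lam j) * oscIntegral lam (fun x => x j * g x) k := by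
  set e : (ι → ℝ) → ℂ := fun x => cexp (I * k * ((∑ i, lam i * x i ^ 2 : ℝ) : ℂ)) with he
  have hesm : ContDiff ℝ (⊤ : ℕ∞) e := by
    rw [he]
    push_cast
    refine ContDiff.cexp (contDiff_const.mul (ContDiff.sum fun i _ => contDiff_const.mul ?_))
    exact (ofRealCLM.contDiff.comp (contDiff_apply ℝ ℝ i)).pow 2
  have hed (x : ι → ℝ) : fderiv ℝ e x (Pi.single j 1) = 2 * I * k * lam j * x j * e x := by
    have hX (i : ι) : HasFDerivAt (fun y : ι → ℝ => y i)
        (ContinuousLinearMap.proj (R := ℝ) (φ := fun _ : ι => ℝ) i) x :=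
      (ContinuousLinearMap.proj (R := ℝ) (φ := fun _ : ι => ℝ) i).hasFDerivAt
    have hq := HasFDerivAt.fun_sum (u := Finset.univ) fun i _ =>
      ((hX i).pow 2).const_mul (lam i)
    have h := ((ofRealCLM.hasFDerivAt.comp x hq).const_mul (I * k)).cexp
    have h' : HasFDerivAt e _ x := h
    rw [h'.fderiv]
    simp [he, Pi.single_apply]
    ring
  have hcont : Continuous (coordDeriv j g) := (contDiff_coordDeriv hg j).continuous
  have hibp := integral_mul_fderiv_eq_neg_fderiv_mul_of_integrable (μ := volume)
    (f := g) (g := e) (v := Pi.single j 1)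
    (integrable_mul_cexp_phase hcont (hasCompactSupport_coordDeriv hgsupp j) k)
    (by
      refine Continuous.integrable_of_hasCompactSupport ?_ hgsupp.mul_right
      exact hg.continuous.mul (contDiff_coordDeriv hesm j).continuous)
    (integrable_mul_cexp_phase hg.continuous hgsupp k)
    (fun x _ => hg.differentiable (by simp) x) (fun x _ => hesm.differentiable (by simp) x)
  have h1 : oscIntegral lam (coordDeriv j g) k = ∫ x, fderiv ℝ g x (Pi.single j 1) * e x := rfl
  rw [h1, ← neg_eq_iff_eq_neg.2 hibp, oscIntegral, neg_mul, ← integral_const_mul]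
  congr 2 with x
  rw [hed]
  ring

theorem oscIntegral_dualLaplacian (hlam : ∀ i, lam i ≠ 0) (hg : ContDiff ℝ (⊤ : ℕ∞) g)
    (hgsupp : HasCompactSupport g) (k : ℝ) :
    oscIntegral lam (dualLaplacian lam g) k =
      2 * I * k * Fintype.card ι * oscIntegral lam g k
        - 4 * k ^ 2 * oscIntegral lam (fun x => ((∑ i, lam i * x i ^ 2 : ℝ) : ℂ) * g x) k := by
  have hX (j : ι) : ContDiff ℝ (⊤ : ℕ∞) fun x : ι → ℝ => (x j : ℂ) :=
    ofRealCLM.contDiff.comp (contDiff_apply ℝ ℝ j)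
  have hmul (j : ι) : oscIntegral lam (fun x => x j * coordDeriv j g x) k =
      -(2 * I * k * lam j) * oscIntegral lam (fun x => x j * (x j * g x)) k
        - oscIntegral lam g k := by
    rw [← oscIntegral_coordDeriv ((hX j).mul hg) hgsupp.mul_left k j, eq_sub_iff_add_eq]
    unfold oscIntegral
    rw [← integral_add (integrable_mul_cexp_phase
        (g := fun x => x j * coordDeriv j g x)
        ((hX j).continuous.mul (contDiff_coordDeriv hg j).continuous)
        (hasCompactSupport_coordDeriv hgsupp j).mul_left k)
      (integrable_mul_cexp_phase hg.continuous hgsupp k)]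
    congr 1 with x
    have hd : coordDeriv j (fun x => (x j : ℂ) * g x) x = x j * coordDeriv j g x + g x := by
      have h1 : HasFDerivAt (fun x : ι → ℝ => (x j : ℂ))
          (ofRealCLM.comp (ContinuousLinearMap.proj j)) x :=
        (ofRealCLM.comp (ContinuousLinearMap.proj (R := ℝ) (φ := fun _ : ι => ℝ) j)).hasFDerivAt
      have h2 := h1.fun_mul (hg.differentiable (by simp) x).hasFDerivAt
      simp [coordDeriv, h2.fderiv]
    rw [hd]
    ring
  have hsecond (j : ι) : oscIntegral lam (coordDeriv j (coordDeriv j g)) k =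
      lam j * (2 * I * k * oscIntegral lam g k -
        4 * k ^ 2 * (lam j * oscIntegral lam (fun x => x j * (x j * g x)) k)) := by
    rw [oscIntegral_coordDeriv (contDiff_coordDeriv hg j) (hasCompactSupport_coordDeriv hgsupp j),
      hmul]
    linear_combination 4 * lam j ^ 2 * k ^ 2 *
      oscIntegral lam (fun x => x j * (x j * g x)) k * I_sq
  have hsum : oscIntegral lam (dualLaplacian lam g) k =
      ∑ j, ((lam j)⁻¹ : ℂ) * oscIntegral lam (coordDeriv j (coordDeriv j g)) k := by
    unfold oscIntegral
    simp_rw [← integral_const_mul]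
    rw [← integral_finsetSum]
    · congr 1 with x
      rw [dualLaplacian, Finset.sum_mul]
      simp only [mul_assoc]
    · intro j _
      refine (integrable_mul_cexp_phase ?_ ?_ k).const_mul _
      · exact (contDiff_coordDeriv (contDiff_coordDeriv hg j) j).continuous
      · exact hasCompactSupport_coordDeriv (hasCompactSupport_coordDeriv hgsupp j) j
  have hphase : oscIntegral lam (fun x => ((∑ i, lam i * x i ^ 2 : ℝ) : ℂ) * g x) k =
      ∑ j, (lam j : ℂ) * oscIntegral lam (fun x => x j * (x j * g x)) k := by
    unfold oscIntegral
    simp_rw [← integral_const_mul]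
    rw [← integral_finsetSum]
    · congr 1 with x
      push_cast
      rw [Finset.sum_mul, Finset.sum_mul]
      refine Finset.sum_congr rfl fun j _ => ?_
      ring
    · intro j _
      refine (integrable_mul_cexp_phase ?_ hgsupp.mul_left.mul_left k).const_mul _
      exact (hX j).continuous.mul ((hX j).continuous.mul hg.continuous)
  have hcancel (j : ι) : ((lam j)⁻¹ : ℂ) * oscIntegral lam (coordDeriv j (coordDeriv j g)) k =
      2 * I * k * oscIntegral lam g k -
        4 * k ^ 2 * (lam j * oscIntegral lam (fun x => x j * (x j * g x)) k) := by
    rw [hsecond, inv_mul_cancel_left₀ (by exact_mod_cast hlam j)]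
  rw [hsum, hphase, Finset.sum_congr rfl fun j _ => hcancel j, Finset.sum_sub_distrib,
    Finset.mul_sum]
  simp
  ring

end Derivatives

theorem hasDerivAt_oscIntegral {lam : ι → ℝ} {g : (ι → ℝ) → ℂ} (hg : Continuous g)
    (hgsupp : HasCompactSupport g) (k : ℝ) :
    HasDerivAt (oscIntegral lam g)
      (I * oscIntegral lam (fun x => ((∑ i, lam i * x i ^ 2 : ℝ) : ℂ) * g x) k) k := by
  have hφ : Continuous fun x : ι → ℝ => ((∑ i, lam i * x i ^ 2 : ℝ) : ℂ) * g x := by fun_prop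
  have h := (hasDerivAt_integral_of_dominated_loc_of_deriv_le (μ := (volume : Measure (ι → ℝ)))
    (F := fun (t : ℝ) x => g x * cexp (I * t * ((∑ i, lam i * x i ^ 2 : ℝ) : ℂ)))
    (F' := fun (t : ℝ) x => I * (((∑ i, lam i * x i ^ 2 : ℝ) : ℂ) * g x *
      cexp (I * t * ((∑ i, lam i * x i ^ 2 : ℝ) : ℂ))))
    (bound := fun x => ‖((∑ i, lam i * x i ^ 2 : ℝ) : ℂ) * g x‖) (x₀ := k) (s := univ)
    univ_mem
    (Eventually.of_forall fun t => (integrable_mul_cexp_phase hg hgsupp t).1)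
    (integrable_mul_cexp_phase hg hgsupp k)
    ((integrable_mul_cexp_phase hφ hgsupp.mul_left k).const_mul I).1
    (ae_of_all _ fun x t _ => ?_)
    (hφ.integrable_of_hasCompactSupport hgsupp.mul_left).norm
    (ae_of_all _ fun x t _ => ?_)).2
  · rw [integral_const_mul] at h
    exact h
  · have hre : (I * t * ((∑ i, lam i * x i ^ 2 : ℝ) : ℂ)).re = 0 := by
      rw [Complex.re_mul_ofReal]
      simp
    rw [norm_mul, norm_mul _ (cexp _), Complex.norm_exp, hre]
    simp
  · have h1 : HasDerivAt (fun t : ℝ => I * t * ((∑ i, lam i * x i ^ 2 : ℝ) : ℂ))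
        (I * 1 * ((∑ i, lam i * x i ^ 2 : ℝ) : ℂ)) t :=
      ((ofRealCLM.hasDerivAt (x := t)).const_mul I).mul_const _
    refine (h1.cexp.const_mul (g x)).congr_deriv ?_
    ring

theorem norm_le_of_norm_deriv_le_of_tendsto_zero {E : Type*} [NormedAddCommGroup E]
    [NormedSpace ℝ E] {f f' : ℝ → E} {C K : ℝ} {M : ℕ} (hK : 0 < K)
    (hf : ∀ t, K ≤ t → HasDerivAt f (f' t) t) (hf' : ∀ t, K ≤ t → ‖f' t‖ ≤ C / t ^ (M + 2))
    (hlim : Tendsto f atTop (𝓝 0)) {k : ℝ} (hk : K ≤ k) : ‖f k‖ ≤ C / k ^ (M + 1) := by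
  have hC : 0 ≤ C := by
    have h := (norm_nonneg _).trans (hf' K le_rfl)
    rwa [le_div_iff₀ (by positivity), zero_mul] at h
  have hkpos : 0 < k := hK.trans_le hk
  set B : ℝ → ℝ := fun t => C / (M + 1) * ((k ^ (M + 1))⁻¹ - (t ^ (M + 1))⁻¹) with hB
  have hBderiv (t : ℝ) (ht : k ≤ t) : HasDerivAt B (C / t ^ (M + 2)) t := by
    have htpos : 0 < t := hkpos.trans_le ht
    have h := (((hasDerivAt_pow (M + 1) t).inv (by positivity)).const_sub
      (k ^ (M + 1))⁻¹).const_mul (C / (M + 1))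
    refine h.congr_deriv ?_
    push_cast
    field_simp
    ring
  have hbound (T : ℝ) (hT : k ≤ T) : ‖f T - f k‖ ≤ C / k ^ (M + 1) := by
    have h := image_norm_le_of_norm_deriv_right_le_deriv_boundary' (a := k) (b := T)
      (f := fun t => f t - f k) (f' := f') (B := B) (B' := fun t => C / t ^ (M + 2))
      (fun t ht => ((hf t (hk.trans ht.1)).sub_const _).continuousAt.continuousWithinAt)
      (fun t ht => ((hf t (hk.trans ht.1)).sub_const _).hasDerivWithinAt)
      (by simp [hB])
      (fun t ht => (hBderiv t ht.1).continuousAt.continuousWithinAt)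
      (fun t ht => (hBderiv t ht.1).hasDerivWithinAt)
      (fun t ht => hf' t (hk.trans ht.1)) (right_mem_Icc.2 hT)
    refine h.trans ?_
    rw [hB, div_eq_mul_inv C (k ^ (M + 1))]
    have hTpos : 0 < T := hkpos.trans_le hT
    have h1 : (k ^ (M + 1))⁻¹ - (T ^ (M + 1))⁻¹ ≤ (k ^ (M + 1))⁻¹ :=
      sub_le_self _ (by positivity)
    have h2 : C / (M + 1) ≤ C := div_le_self hC (by simp)
    exact (mul_le_mul_of_nonneg_left h1 (by positivity)).trans
      (mul_le_mul_of_nonneg_right h2 (by positivity))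
  have hnorm := (hlim.sub_const (f k)).norm
  rw [zero_sub, norm_neg] at hnorm
  exact le_of_tendsto hnorm ((eventually_ge_atTop k).mono hbound)

theorem hasDerivAt_rpow_mul_oscIntegral [DecidableEq ι] {lam : ι → ℝ} {g : (ι → ℝ) → ℂ}
    (hlam : ∀ i, lam i ≠ 0) (hg : ContDiff ℝ (⊤ : ℕ∞) g) (hgsupp : HasCompactSupport g)
    {k : ℝ} (hk : 0 < k) :
    HasDerivAt (fun t : ℝ => ((t ^ ((Fintype.card ι : ℝ) / 2) : ℝ) : ℂ) * oscIntegral lam g t)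
      (((k ^ ((Fintype.card ι : ℝ) / 2) : ℝ) : ℂ) * oscIntegral lam (dualLaplacian lam g) k
        / (4 * I * k ^ 2)) k := by
  have h := ((Real.hasDerivAt_rpow_const (p := (Fintype.card ι : ℝ) / 2)
    (Or.inl hk.ne')).ofReal_comp).mul (hasDerivAt_oscIntegral (lam := lam) hg.continuous hgsupp k)
  refine h.congr_deriv ?_
  have hk' : (k : ℂ) ≠ 0 := by exact_mod_cast hk.ne'
  rw [oscIntegral_dualLaplacian hlam hg hgsupp, Real.rpow_sub_one hk.ne']
  generalize oscIntegral lam (fun x => ((∑ i, lam i * x i ^ 2 : ℝ) : ℂ) * g x) k = J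
  push_cast
  field_simp
  linear_combination (8 * k * (k ^ ((Fintype.card ι : ℝ) / 2) : ℝ) * J) * I_sq

theorem exists_norm_rpow_mul_oscIntegral_le [DecidableEq ι] {lam : ι → ℝ}
    (hlam : ∀ i, lam i ≠ 0) (M : ℕ) :
    ∀ g : (ι → ℝ) → ℂ, ContDiff ℝ (⊤ : ℕ∞) g → HasCompactSupport g →
      (∀ m, m + 2 ≤ 2 * M → iteratedFDeriv ℝ m g 0 = 0) →
      ∃ C K : ℝ, 0 < K ∧ ∀ k, K ≤ k →
        ‖((k ^ ((Fintype.card ι : ℝ) / 2) : ℝ) : ℂ) * oscIntegral lam g k‖ ≤ C / k ^ M := by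
  have hnorm (g : (ι → ℝ) → ℂ) {k : ℝ} (hk : 0 < k) :
      k ^ ((Fintype.card ι : ℝ) / 2) * ‖oscIntegral lam g k‖ =
        ‖((k ^ ((Fintype.card ι : ℝ) / 2) : ℝ) : ℂ) * oscIntegral lam g k‖ := by
    rw [norm_mul, norm_real, Real.norm_of_nonneg (by positivity)]
  induction M with
  | zero =>
    intro g hg hgsupp _
    set L := (∏ i, (Real.pi / |lam i|) ^ (1 / 2 : ℝ)) * ‖g 0‖
    have hev := (tendsto_norm_oscIntegral hlam hg hgsupp).eventually_le_const (lt_add_one L)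
    obtain ⟨K, hK⟩ := eventually_atTop.1 (hev.and (eventually_gt_atTop 0))
    refine ⟨L + 1, K, (hK K le_rfl).2, fun k hk => ?_⟩
    rw [← hnorm g (hK k hk).2, pow_zero, div_one]
    exact (hK k hk).1
  | succ M ih =>
    intro g hg hgsupp hjet
    obtain ⟨C, K, hK, hCK⟩ := ih (dualLaplacian lam g) (contDiff_dualLaplacian hg)
      (hasCompactSupport_dualLaplacian hgsupp) fun m hm =>
        iteratedFDeriv_dualLaplacian_eq_zero (N := m) hg
          (fun i hi => hjet i (by omega)) m le_rfl
    refine ⟨C / 4, K, hK, fun k hk => ?_⟩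
    refine norm_le_of_norm_deriv_le_of_tendsto_zero hK
      (fun t ht => hasDerivAt_rpow_mul_oscIntegral hlam hg hgsupp (hK.trans_le ht))
      (fun t ht => ?_) ?_ hk
    · have htpos : 0 < t := hK.trans_le ht
      have hden : ‖(4 * I * t ^ 2 : ℂ)‖ = 4 * t ^ 2 := by simp
      rw [norm_div, hden, div_le_iff₀ (by positivity)]
      refine (hCK t ht).trans (le_of_eq ?_)
      field_simp
      ring
    · have hg0 : g 0 = 0 := by
        have h := congrArg (fun T => T 0) (hjet 0 (by omega))
        simpa using h
      rw [tendsto_zero_iff_norm_tendsto_zero]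
      have h := tendsto_norm_oscIntegral hlam hg hgsupp
      rw [hg0, norm_zero, mul_zero] at h
      refine h.congr' ?_
      filter_upwards [eventually_gt_atTop 0] with t ht
      exact hnorm g ht

/-- A nondegenerate real quadratic form is diagonal in suitable linear coordinates. -/
theorem exists_continuousLinearEquiv_quadForm {n : ℕ} {Q : Matrix (Fin n) (Fin n) ℝ}
    (hQsymm : Q.IsSymm) (hQdet : Q.det ≠ 0) :
    ∃ (A : (Fin n → ℝ) ≃L[ℝ] (Fin n → ℝ)) (lam : Fin n → ℝ), (∀ i, lam i ≠ 0) ∧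
      ∀ y, quadForm n Q (A y) = ∑ i, lam i * y i ^ 2 := by
  have hQ : Q.IsHermitian := by
    rw [Matrix.IsHermitian, Matrix.conjTranspose_eq_transpose_of_trivial]
    exact hQsymm
  set P : Matrix (Fin n) (Fin n) ℝ := ↑hQ.eigenvectorUnitary
  have h1 : P * star P = 1 := Unitary.coe_mul_star_self _
  have h2 : star P * P = 1 := Unitary.coe_star_mul_self _
  have hD : star P * Q * P = Matrix.diagonal hQ.eigenvalues := by
    have h := hQ.conjStarAlgAut_star_eigenvectorUnitary
    rw [Unitary.conjStarAlgAut_star_apply] at h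
    exact h
  refine ⟨(Matrix.toLin'OfInv h2 h1).toContinuousLinearEquiv, hQ.eigenvalues, fun i hi => ?_,
    fun y => ?_⟩
  · refine hQdet ?_
    rw [hQ.det_eq_prod_eigenvalues]
    exact Finset.prod_eq_zero (Finset.mem_univ i) (by simp [hi])
  · have hA : (Matrix.toLin'OfInv h2 h1).toContinuousLinearEquiv y = P.mulVec y := by
      rw [LinearEquiv.coe_toContinuousLinearEquiv']
      exact Matrix.toLin'_apply P y
    have hq (x : Fin n → ℝ) : quadForm n Q x = x ⬝ᵥ Q.mulVec x := by
      simp only [quadForm, dotProduct, Matrix.mulVec, Finset.mul_sum]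
      refine Finset.sum_congr rfl fun i _ => Finset.sum_congr rfl fun j _ => ?_
      ring
    have hstar : star P = P.transpose := Matrix.conjTranspose_eq_transpose_of_trivial P
    have hPy : P.mulVec y ⬝ᵥ Q.mulVec (P.mulVec y) = y ⬝ᵥ (star P * Q * P).mulVec y := by
      rw [hstar, ← Matrix.mulVec_mulVec, ← Matrix.mulVec_mulVec, Matrix.dotProduct_mulVec y,
        Matrix.vecMul_transpose]
    rw [hA, hq, hPy, hD]
    simp only [dotProduct, Matrix.mulVec_diagonal]
    refine Finset.sum_congr rfl fun i _ => ?_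
    ring

/-- If the smooth compactly supported amplitude `g` vanishes to order `N` at the origin
(all partial derivatives of order `≤ N`, including `g` itself, vanish at `0`) and `Q` is a
nondegenerate symmetric matrix, then
`∫ g(x) e^{ikQ(x,x)} dx = O(k^{-n/2 - ⌊(N+2)/2⌋})` as `k → +∞`. -/
theorem oscillatory_integral_flat_amplitude
    (n N : ℕ) (g : (Fin n → ℝ) → ℂ) (hg : ContDiff ℝ (⊤ : ℕ∞) g)
    (hgsupp : HasCompactSupport g)
    (hjet : ∀ m : ℕ, m ≤ N → iteratedFDeriv ℝ m g 0 = 0)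
    (Q : Matrix (Fin n) (Fin n) ℝ) (hQsymm : Q.IsSymm) (hQdet : Q.det ≠ 0) :
    (fun k : ℝ =>
        ∫ x : Fin n → ℝ, g x * Complex.exp (Complex.I * (k : ℂ) * (quadForm n Q x : ℂ)))
      =O[atTop] fun k : ℝ => k ^ (-(n : ℝ) / 2 - (((N + 2) / 2 : ℕ) : ℝ)) := by
  obtain ⟨A, lam, hlam, hA⟩ := exists_continuousLinearEquiv_quadForm hQsymm hQdet
  have hsm : ContDiff ℝ (⊤ : ℕ∞) (g ∘ A) := hg.comp A.contDiff
  have hsupp : HasCompactSupport (g ∘ A) := hgsupp.comp_homeomorph A.toHomeomorph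
  have hjetA (m : ℕ) (hm : m + 2 ≤ 2 * ((N + 2) / 2)) : iteratedFDeriv ℝ m (g ∘ A) 0 = 0 := by
    have h := (A : (Fin n → ℝ) →L[ℝ] (Fin n → ℝ)).iteratedFDeriv_comp_right (i := m) hg 0
      (by exact_mod_cast le_top)
    rw [map_zero, hjet m (by omega)] at h
    refine h.trans ?_
    ext v
    simp
  obtain ⟨C, K, hK, hCK⟩ := exists_norm_rpow_mul_oscIntegral_le hlam ((N + 2) / 2) (g ∘ A)
    hsm hsupp hjetA
  set a : ℝ := |(LinearMap.det (A : (Fin n → ℝ) →ₗ[ℝ] (Fin n → ℝ)))⁻¹|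
  have hdet : LinearMap.det (A : (Fin n → ℝ) →ₗ[ℝ] (Fin n → ℝ)) ≠ 0 :=
    (LinearEquiv.isUnit_det' A.toLinearEquiv).ne_zero
  have ha0 : 0 < a := abs_pos.2 (inv_ne_zero hdet)
  have hchange (k : ℝ) : oscIntegral lam (g ∘ A) k =
      a * ∫ x : Fin n → ℝ, g x * cexp (I * (k : ℂ) * (quadForm n Q x : ℂ)) := by
    have hmap := Measure.map_linearMap_addHaar_eq_smul_addHaar
      (volume : Measure (Fin n → ℝ)) hdet
    have h := A.toHomeomorph.measurableEmbedding.integral_map (μ := volume)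
      (fun x : Fin n → ℝ => g x * cexp (I * (k : ℂ) * (quadForm n Q x : ℂ)))
    have hmap' : Measure.map A.toHomeomorph (volume : Measure (Fin n → ℝ)) =
      ENNReal.ofReal a • volume := hmap
    rw [hmap', integral_smul_measure, ENNReal.toReal_ofReal ha0.le, real_smul] at h
    rw [h, oscIntegral]
    congr 1 with y
    rw [← hA]
    rfl
  refine IsBigO.of_bound (a⁻¹ * C) ?_
  filter_upwards [eventually_ge_atTop K] with k hk
  have hkpos : 0 < k := hK.trans_le hk
  have h := hCK k hk
  rw [hchange, norm_mul, norm_mul, norm_real, norm_real, Real.norm_of_nonneg ha0.le,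
    Real.norm_of_nonneg (by positivity), Fintype.card_fin] at h
  rw [Real.norm_of_nonneg (by positivity), Real.rpow_sub hkpos, neg_div, Real.rpow_neg hkpos.le,
    Real.rpow_natCast]
  have hkn : 0 < k ^ ((n : ℝ) / 2) := by positivity
  rw [mul_left_comm, ← le_div_iff₀' ha0, ← le_div_iff₀' hkn] at h
  refine h.trans (le_of_eq ?_)
  field_simp
end
end

section
/- Let g : ℝⁿ → ℂ be smooth with compact support and let f : ℝⁿ → ℝ be smooth with no critical points on supp g, i.e., the derivative of f is nonzero at every point of supp g. Then for every natural number N, ∫_{ℝⁿ} g(x) e^{i k f(x)} dx = O(k^{-N}) as k → +∞. -/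
open MeasureTheory Filter Asymptotics

/-- A function which is smooth at every point of its topological support is smooth. -/
lemma contDiff_of_forall_mem_tsupport {E F : Type*} [NormedAddCommGroup E] [NormedSpace ℝ E]
    [NormedAddCommGroup F] [NormedSpace ℝ F] {m : WithTop ℕ∞} {h : E → F} {s : Set E}
    (hs : tsupport h ⊆ s) (H : ∀ x ∈ s, ContDiffAt ℝ m h x) : ContDiff ℝ m h := by
  rw [contDiff_iff_contDiffAt]
  intro x
  by_cases hx : x ∈ s
  · exact H x hx
  · exact contDiffAt_const.congr_of_eventuallyEq
      (notMem_tsupport_iff_eventuallyEq.mp fun h => hx (hs h))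

/-- If `f` has no critical point on `tsupport g`, then `g` is a combination of the partial
derivatives of `f` with smooth coefficients supported in `tsupport g`. -/
lemma exists_eq_sum_mul_fderiv {n : ℕ} {g : (Fin n → ℝ) → ℂ} (hg : ContDiff ℝ (⊤ : ℕ∞) g)
    {f : (Fin n → ℝ) → ℝ} (hf : ContDiff ℝ (⊤ : ℕ∞) f)
    (hcrit : ∀ x ∈ tsupport g, fderiv ℝ f x ≠ 0) :
    ∃ h : Fin n → (Fin n → ℝ) → ℂ, (∀ j, ContDiff ℝ (⊤ : ℕ∞) (h j)) ∧
      (∀ j, tsupport (h j) ⊆ tsupport g) ∧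
      ∀ x, g x = ∑ j, h j x * (fderiv ℝ f x (Pi.single j 1) : ℂ) := by
  set d : Fin n → (Fin n → ℝ) → ℝ := fun j x => fderiv ℝ f x (Pi.single j 1) with hd
  set q : (Fin n → ℝ) → ℝ := fun x => ∑ j, d j x ^ 2 with hq
  have hd_smooth (j) : ContDiff ℝ (⊤ : ℕ∞) (d j) :=
    (hf.fderiv_right (m := (⊤ : ℕ∞)) (by simp)).clm_apply contDiff_const
  have hq_smooth : ContDiff ℝ (⊤ : ℕ∞) q := ContDiff.sum fun j _ => (hd_smooth j).pow 2
  have hq_ne : ∀ x ∈ tsupport g, q x ≠ 0 := by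
    intro x hx h0
    rw [hq, Finset.sum_eq_zero_iff_of_nonneg fun j _ => sq_nonneg _] at h0
    refine hcrit x hx (ContinuousLinearMap.coe_injective (LinearMap.pi_ext' fun j => ?_))
    ext
    simpa [hd] using h0 j (Finset.mem_univ j)
  have hsupp (j) : tsupport (fun x => g x * ((d j x / q x : ℝ) : ℂ)) ⊆ tsupport g :=
    tsupport_mul_subset_left
  refine ⟨fun j x => g x * ((d j x / q x : ℝ) : ℂ), fun j => ?_, hsupp, fun x => ?_⟩
  · refine contDiff_of_forall_mem_tsupport (hsupp j) fun x hx => hg.contDiffAt.mul ?_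
    exact Complex.ofRealCLM.contDiff.contDiffAt.comp x
      ((hd_smooth j).contDiffAt.div hq_smooth.contDiffAt (hq_ne x hx))
  · by_cases hx : x ∈ tsupport g
    · have h1 : ∑ j, d j x / q x * d j x = 1 := by
        rw [← div_self (hq_ne x hx)]
        conv_rhs => rw [hq, Finset.sum_div]
        exact Finset.sum_congr rfl fun j _ => by ring
      calc g x = g x * ((∑ j, d j x / q x * d j x : ℝ) : ℂ) := by rw [h1]; simp
        _ = _ := by
          push_cast
          rw [Finset.mul_sum]
          exact Finset.sum_congr rfl fun j _ => by rw [mul_assoc]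
    · simp [image_eq_zero_of_notMem_tsupport hx]

/-- Integration by parts against an oscillating exponential. -/
lemma integral_mul_fderiv_mul_exp {n : ℕ} {h : (Fin n → ℝ) → ℂ}
    (hh : ContDiff ℝ (⊤ : ℕ∞) h) (hsupp : HasCompactSupport h)
    {f : (Fin n → ℝ) → ℝ} (hf : ContDiff ℝ (⊤ : ℕ∞) f) (k : ℝ) (v : Fin n → ℝ) :
    Complex.I * k * ∫ x, h x * (fderiv ℝ f x v : ℂ) * Complex.exp (Complex.I * k * f x) =
      -∫ x, fderiv ℝ h x v * Complex.exp (Complex.I * k * f x) := by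
  set e : (Fin n → ℝ) → ℂ := fun x => Complex.exp (Complex.I * k * f x) with he
  have he_smooth : ContDiff ℝ (⊤ : ℕ∞) e :=
    (contDiff_const.mul (Complex.ofRealCLM.contDiff.comp hf)).cexp
  have he_fderiv (x) : fderiv ℝ e x v = e x * (Complex.I * k * (fderiv ℝ f x v : ℂ)) := by
    have hfx : HasFDerivAt f (fderiv ℝ f x) x :=
      (hf.differentiable (by simp) x).hasFDerivAt
    have := ((Complex.ofRealCLM.hasFDerivAt.comp x hfx).const_mul (Complex.I * (k : ℂ))).cexp
    have h2 := this.fderiv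
    simp only [Function.comp_def, Complex.ofRealCLM_apply] at h2
    rw [he, h2]
    simp
  have hh' : Continuous fun x => fderiv ℝ h x v :=
    (hh.continuous_fderiv (by simp)).clm_apply continuous_const
  have he' : Continuous fun x => fderiv ℝ e x v :=
    (he_smooth.continuous_fderiv (by simp)).clm_apply continuous_const
  rw [← integral_mul_fderiv_eq_neg_fderiv_mul_of_integrable
    ((hh'.mul he_smooth.continuous).integrable_of_hasCompactSupport
      (hsupp.fderiv_apply ℝ v).mul_right)
    ((hh.continuous.mul he').integrable_of_hasCompactSupport hsupp.mul_right)
    ((hh.continuous.mul he_smooth.continuous).integrable_of_hasCompactSupport hsupp.mul_right)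
    (fun x _ => hh.differentiable (by simp) x)
    (fun x _ => he_smooth.differentiable (by simp) x), ← integral_const_mul]
  refine integral_congr_ae (.of_forall fun x => ?_)
  simp only [he_fderiv]
  ring

/-- Dividing by the gradient of the phase and integrating by parts gains a factor `k⁻¹`. -/
lemma exists_mul_integral_exp_eq {n : ℕ} {g : (Fin n → ℝ) → ℂ}
    (hg : ContDiff ℝ (⊤ : ℕ∞) g) (hgsupp : HasCompactSupport g)
    {f : (Fin n → ℝ) → ℝ} (hf : ContDiff ℝ (⊤ : ℕ∞) f)
    (hcrit : ∀ x ∈ tsupport g, fderiv ℝ f x ≠ 0) :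
    ∃ G : (Fin n → ℝ) → ℂ, ContDiff ℝ (⊤ : ℕ∞) G ∧ tsupport G ⊆ tsupport g ∧
      ∀ k : ℝ, Complex.I * k * ∫ x, g x * Complex.exp (Complex.I * k * f x) =
        ∫ x, G x * Complex.exp (Complex.I * k * f x) := by
  obtain ⟨h, hh, hsub, hgh⟩ := exists_eq_sum_mul_fderiv hg hf hcrit
  have hsupp (j) : HasCompactSupport (h j) := hgsupp.mono' (subset_closure.trans (hsub j))
  have hh' (j) : ContDiff ℝ (⊤ : ℕ∞) fun x => fderiv ℝ (h j) x (Pi.single j 1) :=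
    ((hh j).fderiv_right (m := (⊤ : ℕ∞)) (by simp)).clm_apply contDiff_const
  refine ⟨fun x => -∑ j, fderiv ℝ (h j) x (Pi.single j 1),
    (ContDiff.sum fun j _ => hh' j).neg, ?_, fun k => ?_⟩
  · refine closure_minimal (fun x hx => ?_) (isClosed_tsupport g)
    by_contra hxg
    refine hx ?_
    simp only [neg_eq_zero]
    refine Finset.sum_eq_zero fun j _ => ?_
    exact image_eq_zero_of_notMem_tsupport
      (f := fun y => fderiv ℝ (h j) y (Pi.single j 1)) fun hxj =>
        hxg (hsub j (tsupport_fderiv_apply_subset ℝ _ hxj))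
  · have he : Continuous fun x => Complex.exp (Complex.I * k * f x) := by
      have := hf.continuous
      fun_prop
    have hdf (j : Fin n) : Continuous fun x => (fderiv ℝ f x (Pi.single j 1) : ℂ) :=
      Complex.continuous_ofReal.comp
        ((hf.continuous_fderiv (by simp)).clm_apply continuous_const)
    simp_rw [hgh, Finset.sum_mul, neg_mul, Finset.sum_mul]
    rw [integral_neg, integral_finsetSum, integral_finsetSum, Finset.mul_sum,
      ← Finset.sum_neg_distrib]
    · exact Finset.sum_congr rfl fun j _ =>
        integral_mul_fderiv_mul_exp (hh j) (hsupp j) hf k _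
    · exact fun j _ => ((hh' j).continuous.mul he).integrable_of_hasCompactSupport
        ((hsupp j).fderiv_apply ℝ _).mul_right
    · exact fun j _ => (((hh j).continuous.mul (hdf j)).mul he).integrable_of_hasCompactSupport
        (hsupp j).mul_right.mul_right

/-- **Nonstationary phase lemma**: if the smooth phase `f` has no critical points on the
support of the smooth compactly supported amplitude `g`, then
`∫ g(x) e^{ikf(x)} dx = O(k^{-N})` as `k → +∞` for every natural number `N`. -/
theorem nonstationary_phase
    (n : ℕ) (g : (Fin n → ℝ) → ℂ) (hg : ContDiff ℝ (⊤ : ℕ∞) g)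
    (hgsupp : HasCompactSupport g)
    (f : (Fin n → ℝ) → ℝ) (hf : ContDiff ℝ (⊤ : ℕ∞) f)
    (hcrit : ∀ x ∈ tsupport g, fderiv ℝ f x ≠ 0) (N : ℕ) :
    (fun k : ℝ => ∫ x : Fin n → ℝ, g x * Complex.exp (Complex.I * (k : ℂ) * (f x : ℂ)))
      =O[atTop] fun k : ℝ => k ^ (-(N : ℝ)) := by
  induction N generalizing g with
  | zero =>
    refine IsBigO.of_bound (∫ x, ‖g x‖) (.of_forall fun k => ?_)
    refine (norm_integral_le_integral_norm _).trans_eq ?_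
    have hexp (x : Fin n → ℝ) : ‖Complex.exp (Complex.I * k * f x)‖ = 1 := by
      rw [mul_assoc, ← Complex.ofReal_mul, mul_comm, Complex.norm_exp_ofReal_mul_I]
    simp [hexp]
  | succ N ih =>
    obtain ⟨G, hG, hGsub, hGint⟩ := exists_mul_integral_exp_eq hg hgsupp hf hcrit
    have hGO := ih G hG (hgsupp.mono' (subset_closure.trans hGsub))
      fun x hx => hcrit x (hGsub hx)
    have hinv : (fun k : ℝ => (Complex.I * (k : ℂ))⁻¹) =O[atTop] fun k : ℝ => k⁻¹ :=
      IsBigO.of_bound 1 (.of_forall fun k => by simp)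
    refine (hinv.mul hGO).congr' ?_ ?_
    · filter_upwards [eventually_gt_atTop 0] with k hk
      rw [← hGint k, inv_mul_cancel_left₀]
      simp [hk.ne']
    · filter_upwards [eventually_gt_atTop 0] with k hk
      rw [← Real.rpow_neg_one, ← Real.rpow_add hk]
      congr 1
      push_cast
      ring
end

section
/- Let g : ℝⁿ → ℂ be smooth with compact support such that all iterated partial derivatives of g of every order (including g itself) vanish at the origin, and let Q be a nondegenerate real symmetric n×n matrix. Then for every natural number N, ∫_{ℝⁿ} g(x) e^{i k Q(x,x)} dx = O(k^{-N}) as k → +∞. -/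
open MeasureTheory Filter Asymptotics

noncomputable section

section Flat

open Topology

/-- A smooth function all of whose derivatives vanish at the origin. -/
structure FlatAtZero {E F : Type} [NormedAddCommGroup E] [NormedSpace ℝ E]
    [NormedAddCommGroup F] [NormedSpace ℝ F] (f : E → F) : Prop where
  contDiff : ContDiff ℝ (⊤ : ℕ∞) f
  jet_eq_zero : ∀ m : ℕ, iteratedFDeriv ℝ m f 0 = 0

namespace FlatAtZero

variable {E F : Type} [NormedAddCommGroup E] [NormedSpace ℝ E]
  [NormedAddCommGroup F] [NormedSpace ℝ F]

theorem apply_zero {f : E → F} (hf : FlatAtZero f) : f 0 = 0 := by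
  have h := norm_iteratedFDeriv_zero (𝕜 := ℝ) (f := f) (x := 0)
  rw [hf.jet_eq_zero, norm_zero] at h
  exact norm_eq_zero.mp h.symm

theorem fderiv {f : E → F} (hf : FlatAtZero f) : FlatAtZero (fderiv ℝ f) where
  contDiff := hf.contDiff.fderiv_right le_rfl
  jet_eq_zero m := by
    rw [← norm_eq_zero, norm_iteratedFDeriv_fderiv, hf.jet_eq_zero, norm_zero]

theorem fderiv_apply {f : E → F} (hf : FlatAtZero f) (v : E) :
    FlatAtZero fun x => _root_.fderiv ℝ f x v where
  contDiff := hf.fderiv.contDiff.clm_apply contDiff_const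
  jet_eq_zero m := by
    rw [← norm_le_zero_iff]
    refine (norm_iteratedFDeriv_clm_apply_const (N := (⊤ : ℕ∞))
      hf.fderiv.contDiff.contDiffAt (by exact_mod_cast le_top)).trans ?_
    rw [hf.fderiv.jet_eq_zero, norm_zero, mul_zero]

theorem smul {p : E → ℝ} {f : E → F} (hf : FlatAtZero f) (hp : ContDiff ℝ (⊤ : ℕ∞) p) :
    FlatAtZero fun x => p x • f x where
  contDiff := hp.smul hf.contDiff
  jet_eq_zero m := by
    rw [← norm_le_zero_iff]
    refine (norm_iteratedFDeriv_smul_le (N := (⊤ : ℕ∞)) hp hf.contDiff 0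
      (by exact_mod_cast le_top)).trans ?_
    simp [hf.jet_eq_zero]

theorem add {f g : E → F} (hf : FlatAtZero f) (hg : FlatAtZero g) :
    FlatAtZero fun x => f x + g x where
  contDiff := hf.contDiff.add hg.contDiff
  jet_eq_zero m := by
    have h := iteratedFDeriv_add_apply (i := m) (x := (0 : E))
      (hf.contDiff.contDiffAt.of_le (by exact_mod_cast le_top))
      (hg.contDiff.contDiffAt.of_le (by exact_mod_cast le_top))
    rw [hf.jet_eq_zero, hg.jet_eq_zero, add_zero] at h
    exact h

theorem isBigO_norm_pow {f : E → F} (hf : FlatAtZero f) (p : ℕ) :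
    f =O[𝓝 0] fun x => ‖x‖ ^ p := by
  induction p generalizing F with
  | zero =>
    simpa using hf.contDiff.continuous.continuousAt.norm.isBoundedUnder_le.isBigO_one ℝ
  | succ p ih =>
    obtain ⟨C, hC⟩ := (ih hf.fderiv).bound
    obtain ⟨ε, hε, hball⟩ := Metric.eventually_nhds_iff_ball.mp hC
    refine IsBigO.of_bound |C| (Metric.eventually_nhds_iff_ball.mpr ⟨ε, hε, fun x hx => ?_⟩)
    have hsub : ∀ y ∈ Metric.closedBall (0 : E) ‖x‖,
        ‖_root_.fderiv ℝ f y‖ ≤ |C| * ‖x‖ ^ p := by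
      intro y hy
      rw [mem_closedBall_zero_iff] at hy
      rw [mem_ball_zero_iff] at hx
      have h := hball y (by rw [mem_ball_zero_iff]; exact hy.trans_lt hx)
      rw [norm_pow, norm_norm] at h
      refine h.trans ?_
      gcongr
      exact le_abs_self C
    have h := (convex_closedBall (0 : E) ‖x‖).norm_image_sub_le_of_norm_fderiv_le
      (fun y _ => (hf.contDiff.differentiable (by simp)) y) hsub
      (x := 0) (y := x) (by simp) (by simp)
    rw [hf.apply_zero, sub_zero, sub_zero] at h
    rw [norm_pow, norm_norm, pow_succ, ← mul_assoc]
    exact h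

end FlatAtZero

end Flat

section Quotients

open Topology Matrix

variable {n : ℕ}

theorem norm_sq_le_dotProduct_self (x : Fin n → ℝ) : ‖x‖ ^ 2 ≤ x ⬝ᵥ x := by
  have hnn : 0 ≤ x ⬝ᵥ x := Finset.sum_nonneg fun i _ => mul_self_nonneg _
  refine Real.le_sqrt (norm_nonneg _) hnn |>.mp ?_
  refine (pi_norm_le_iff_of_nonneg (Real.sqrt_nonneg _)).mpr fun i => ?_
  refine Real.le_sqrt (norm_nonneg _) hnn |>.mpr ?_
  rw [Real.norm_eq_abs, sq_abs, sq]
  exact Finset.single_le_sum (f := fun i => x i * x i)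
    (fun i _ => mul_self_nonneg _) (Finset.mem_univ i)

theorem contDiff_dotProduct_self : ContDiff ℝ (⊤ : ℕ∞) fun x : Fin n → ℝ => x ⬝ᵥ x := by
  unfold dotProduct
  fun_prop

theorem contDiff_dotProduct_const (v : Fin n → ℝ) :
    ContDiff ℝ (⊤ : ℕ∞) fun x : Fin n → ℝ => x ⬝ᵥ v := by
  unfold dotProduct
  fun_prop

/-- The quotient of `f` by the `a`-th power of the squared Euclidean norm. -/
def radialQuotient (a : ℕ) (f : (Fin n → ℝ) → ℂ) (x : Fin n → ℝ) : ℂ :=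
  ((x ⬝ᵥ x) ^ a)⁻¹ • f x

/-- The numerator of the derivative along `v` of `radialQuotient a f`. -/
def radialQuotientDerivNumerator (a : ℕ) (f : (Fin n → ℝ) → ℂ) (v x : Fin n → ℝ) : ℂ :=
  (x ⬝ᵥ x) • fderiv ℝ f x v + (-(2 * a * (x ⬝ᵥ v))) • f x

theorem FlatAtZero.radialQuotientDerivNumerator {f : (Fin n → ℝ) → ℂ} (hf : FlatAtZero f)
    (a : ℕ) (v : Fin n → ℝ) : FlatAtZero (radialQuotientDerivNumerator a f v) :=
  ((hf.fderiv_apply v).smul contDiff_dotProduct_self).add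
    (hf.smul ((contDiff_const.mul (contDiff_dotProduct_const v)).neg))

theorem hasCompactSupport_radialQuotientDerivNumerator {f : (Fin n → ℝ) → ℂ}
    (hf : HasCompactSupport f) (a : ℕ) (v : Fin n → ℝ) :
    HasCompactSupport (radialQuotientDerivNumerator a f v) := by
  have h₁ := (hf.fderiv_apply (𝕜 := ℝ) v).smul_left (f := fun x : Fin n → ℝ => x ⬝ᵥ x)
  have h₂ := hf.smul_left (f := fun x : Fin n → ℝ => -(2 * a * (x ⬝ᵥ v)))
  exact h₁.add h₂

theorem hasCompactSupport_radialQuotient {f : (Fin n → ℝ) → ℂ}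
    (hf : HasCompactSupport f) (a : ℕ) : HasCompactSupport (radialQuotient a f) :=
  hf.smul_left (f := fun x : Fin n → ℝ => ((x ⬝ᵥ x) ^ a)⁻¹)

theorem FlatAtZero.radialQuotient_isBigO {f : (Fin n → ℝ) → ℂ} (hf : FlatAtZero f) (a : ℕ) :
    radialQuotient a f =O[𝓝 0] fun x => ‖x‖ ^ 2 := by
  obtain ⟨C, hC⟩ := (hf.isBigO_norm_pow (2 * a + 2)).bound
  refine IsBigO.of_bound C (hC.mono fun x hx => ?_)
  rcases eq_or_ne x 0 with rfl | hx0
  · simp [radialQuotient, hf.apply_zero]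
  have hpos : 0 < ‖x‖ ^ 2 := by positivity
  have hr := norm_sq_le_dotProduct_self x
  have hr0 : 0 < (x ⬝ᵥ x) ^ a := pow_pos (hpos.trans_le hr) a
  rw [norm_pow, norm_norm] at hx ⊢
  have hC0 : 0 ≤ C * ‖x‖ ^ 2 := by
    have : 0 ≤ C * ‖x‖ ^ (2 * a + 2) := (norm_nonneg _).trans hx
    have hC : 0 ≤ C := nonneg_of_mul_nonneg_left this (by positivity)
    positivity
  rw [radialQuotient, norm_smul, norm_inv, Real.norm_of_nonneg hr0.le, inv_mul_le_iff₀ hr0]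
  calc ‖f x‖ ≤ (‖x‖ ^ 2) ^ a * (C * ‖x‖ ^ 2) := by rw [← pow_mul]; exact hx.trans_eq (by ring)
    _ ≤ _ := by gcongr

theorem hasLineDerivAt_dotProduct_self (x v : Fin n → ℝ) :
    HasLineDerivAt ℝ (fun y : Fin n → ℝ => y ⬝ᵥ y) (2 * (x ⬝ᵥ v)) x v := by
  have h : (fun t : ℝ => (x + t • v) ⬝ᵥ (x + t • v))
      = fun t => x ⬝ᵥ x + t * (2 * (x ⬝ᵥ v)) + t ^ 2 * (v ⬝ᵥ v) := by
    funext t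
    simp only [add_dotProduct, dotProduct_add, smul_dotProduct, dotProduct_smul, smul_eq_mul,
      dotProduct_comm v x]
    ring
  unfold HasLineDerivAt
  rw [h]
  have := (((hasDerivAt_id (0 : ℝ)).mul_const (2 * (x ⬝ᵥ v))).const_add (x ⬝ᵥ x)).fun_add
    (((hasDerivAt_id (0 : ℝ)).pow 2).mul_const (v ⬝ᵥ v))
  simpa using this

theorem FlatAtZero.differentiable_radialQuotient {f : (Fin n → ℝ) → ℂ} (hf : FlatAtZero f)
    (a : ℕ) : Differentiable ℝ (radialQuotient a f) := by
  intro x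
  rcases eq_or_ne x 0 with rfl | hx0
  · have h : radialQuotient a f =O[𝓝 0] fun x => ‖x - 0‖ ^ 2 := by
      simpa using hf.radialQuotient_isBigO a
    exact (h.hasFDerivAt (𝕜 := ℝ) one_lt_two).differentiableAt
  · have hr : (x ⬝ᵥ x) ^ a ≠ 0 := pow_ne_zero _ (dotProduct_self_eq_zero.not.mpr hx0)
    exact (((contDiff_dotProduct_self.differentiable (by simp) x).pow a).inv hr).smul
      (hf.contDiff.differentiable (by simp) x)

theorem FlatAtZero.hasLineDerivAt_radialQuotient {f : (Fin n → ℝ) → ℂ} (hf : FlatAtZero f)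
    (a : ℕ) (x v : Fin n → ℝ) :
    HasLineDerivAt ℝ (radialQuotient a f)
      (radialQuotient (a + 1) (_root_.radialQuotientDerivNumerator a f v) x) x v := by
  rcases eq_or_ne x 0 with rfl | hx0
  · have h : radialQuotient a f =O[𝓝 0] fun x => ‖x - 0‖ ^ 2 := by
      simpa using hf.radialQuotient_isBigO a
    simpa [radialQuotient] using (h.hasFDerivAt (𝕜 := ℝ) one_lt_two).hasLineDerivAt v
  · have hr : x ⬝ᵥ x ≠ 0 := dotProduct_self_eq_zero.not.mpr hx0
    have hf' : HasLineDerivAt ℝ f (_root_.fderiv ℝ f x v) x v :=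
      (hf.contDiff.differentiable (by simp) x).hasFDerivAt.hasLineDerivAt v
    have hr' := hasLineDerivAt_dotProduct_self x v
    unfold HasLineDerivAt at hf' hr' ⊢
    have h := ((hr'.fun_pow a).fun_inv (by simpa using pow_ne_zero a hr)).fun_smul hf'
    refine h.congr_deriv ?_
    simp only [zero_smul, add_zero, radialQuotient, _root_.radialQuotientDerivNumerator,
      Complex.real_smul]
    have hrC : ((x ⬝ᵥ x : ℝ) : ℂ) ≠ 0 := by exact_mod_cast hr
    push_cast
    rcases a with _ | a
    · simp
      field_simp
    · simp only [Nat.add_sub_cancel]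
      push_cast
      field_simp
      ring

theorem radialQuotient_eq_sum {f : (Fin n → ℝ) → ℂ} (hf : f 0 = 0) (a : ℕ) (x : Fin n → ℝ) :
    radialQuotient a f x
      = ∑ j, (x j : ℂ) * radialQuotient (a + 1) (fun y => y j • f y) x := by
  rcases eq_or_ne x 0 with rfl | hx0
  · simp [radialQuotient, hf]
  have hr : ((x ⬝ᵥ x : ℝ) : ℂ) ≠ 0 := by exact_mod_cast dotProduct_self_eq_zero.not.mpr hx0
  have hsum : ∑ j, (x j : ℂ) * (x j : ℂ) = ((x ⬝ᵥ x : ℝ) : ℂ) := by simp [dotProduct]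
  simp only [radialQuotient, Complex.real_smul]
  push_cast
  calc (((x ⬝ᵥ x : ℝ) : ℂ) ^ a)⁻¹ * f x
      = (∑ j, (x j : ℂ) * (x j : ℂ)) * ((((x ⬝ᵥ x : ℝ) : ℂ) ^ (a + 1))⁻¹ * f x) := by
        rw [hsum]; field_simp; ring
    _ = _ := by rw [Finset.sum_mul]; exact Finset.sum_congr rfl fun j _ => by ring

end Quotients

section Phase

open Matrix

variable {n : ℕ} (Q : Matrix (Fin n) (Fin n) ℝ)

theorem quadForm_eq_dotProduct (x : Fin n → ℝ) : quadForm n Q x = x ⬝ᵥ Q *ᵥ x := by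
  simp only [quadForm, dotProduct, mulVec, Finset.mul_sum]
  exact Finset.sum_congr rfl fun i _ => Finset.sum_congr rfl fun j _ => by ring

theorem continuous_quadForm : Continuous (quadForm n Q) := by
  unfold quadForm
  fun_prop

/-- The oscillating factor `e^{ikQ(x,x)}`. -/
def quadPhase (k : ℝ) (x : Fin n → ℝ) : ℂ :=
  Complex.exp (Complex.I * (k : ℂ) * (quadForm n Q x : ℂ))

theorem continuous_quadPhase (k : ℝ) : Continuous (quadPhase Q k) := by
  have := continuous_quadForm Q
  unfold quadPhase
  fun_prop

theorem norm_quadPhase (k : ℝ) (x : Fin n → ℝ) : ‖quadPhase Q k x‖ = 1 := by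
  have h : Complex.I * (k : ℂ) * (quadForm n Q x : ℂ)
      = ((k * quadForm n Q x : ℝ) : ℂ) * Complex.I := by
    push_cast; ring
  rw [quadPhase, h, Complex.norm_exp_ofReal_mul_I]

variable {Q}

theorem hasLineDerivAt_quadForm (hQ : Q.IsSymm) (x v : Fin n → ℝ) :
    HasLineDerivAt ℝ (quadForm n Q) (2 * (x ⬝ᵥ Q *ᵥ v)) x v := by
  have hsymm : v ⬝ᵥ Q *ᵥ x = x ⬝ᵥ Q *ᵥ v := by
    rw [dotProduct_mulVec, ← mulVec_transpose, hQ.eq, dotProduct_comm]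
  have h : (fun t : ℝ => quadForm n Q (x + t • v))
      = fun t => x ⬝ᵥ Q *ᵥ x + t * (2 * (x ⬝ᵥ Q *ᵥ v)) + t ^ 2 * (v ⬝ᵥ Q *ᵥ v) := by
    funext t
    simp only [quadForm_eq_dotProduct, mulVec_add, mulVec_smul, add_dotProduct, dotProduct_add,
      smul_dotProduct, dotProduct_smul, smul_eq_mul, hsymm]
    ring
  unfold HasLineDerivAt
  rw [h]
  have := (((hasDerivAt_id (0 : ℝ)).mul_const (2 * (x ⬝ᵥ Q *ᵥ v))).const_add (x ⬝ᵥ Q *ᵥ x)).fun_add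
    (((hasDerivAt_id (0 : ℝ)).pow 2).mul_const (v ⬝ᵥ Q *ᵥ v))
  simpa using this

theorem hasLineDerivAt_quadPhase (hQ : Q.IsSymm) (k : ℝ) (x v : Fin n → ℝ) :
    HasLineDerivAt ℝ (quadPhase Q k)
      (2 * Complex.I * k * ((x ⬝ᵥ Q *ᵥ v : ℝ) : ℂ) * quadPhase Q k x) x v := by
  have h := hasLineDerivAt_quadForm hQ x v
  unfold HasLineDerivAt at h ⊢
  refine ((h.ofReal_comp.const_mul (Complex.I * (k : ℂ))).cexp).congr_deriv ?_
  simp only [zero_smul, add_zero, quadPhase]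
  push_cast
  ring

/-- Multiplying a differentiable compactly supported amplitude by a coordinate gains a factor
`k⁻¹`, at the price of one derivative along a column of `Q⁻¹`. -/
theorem integral_coord_mul_quadPhase (hQ : Q.IsSymm) (hdet : Q.det ≠ 0) (j : Fin n)
    {u u' : (Fin n → ℝ) → ℂ} (hu : Continuous u) (hu' : Continuous u')
    (hus : HasCompactSupport u) (hus' : HasCompactSupport u')
    (hderiv : ∀ x, HasLineDerivAt ℝ u (u' x) x (Q⁻¹ *ᵥ Pi.single j 1)) {k : ℝ} (hk : k ≠ 0) :
    ∫ x, (x j : ℂ) * u x * quadPhase Q k x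
      = -(2 * Complex.I * k)⁻¹ * ∫ x, u' x * quadPhase Q k x := by
  have hc := continuous_quadPhase Q k
  have hQv : Q *ᵥ (Q⁻¹ *ᵥ Pi.single j 1) = Pi.single j 1 := by
    rw [mulVec_mulVec, mul_nonsing_inv _ (isUnit_iff_ne_zero.mpr hdet), one_mulVec]
  have hphase : ∀ x, HasLineDerivAt ℝ (quadPhase Q k)
      (2 * Complex.I * k * (x j : ℂ) * quadPhase Q k x) x (Q⁻¹ *ᵥ Pi.single j 1) := by
    intro x
    have h := hasLineDerivAt_quadPhase hQ k x (Q⁻¹ *ᵥ Pi.single j 1)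
    rwa [hQv, dotProduct_single_one] at h
  have hparts := integral_bilinear_hasLineDerivAt_right_eq_neg_left_of_integrable
    (μ := volume) (B := ContinuousLinearMap.mul ℝ ℂ)
    (f := u) (f' := u') (g := quadPhase Q k)
    (g' := fun x => 2 * Complex.I * k * (x j : ℂ) * quadPhase Q k x)
    (v := Q⁻¹ *ᵥ Pi.single j 1)
    ((hu'.mul hc).integrable_of_hasCompactSupport hus'.mul_right)
    (Continuous.integrable_of_hasCompactSupport (by simp; fun_prop) hus.mul_right)
    ((hu.mul hc).integrable_of_hasCompactSupport hus.mul_right)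
    (fun x _ => hderiv x) (fun x _ => hphase x)
  simp only [ContinuousLinearMap.mul_apply'] at hparts
  have hk' : (2 * Complex.I * k : ℂ) ≠ 0 := by simp [hk]
  have hpull : ∫ x, u x * (2 * Complex.I * k * (x j : ℂ) * quadPhase Q k x)
      = 2 * Complex.I * k * ∫ x, (x j : ℂ) * u x * quadPhase Q k x := by
    rw [← integral_const_mul]
    exact integral_congr_ae (.of_forall fun x => by ring)
  rw [hpull] at hparts
  rw [neg_mul, ← mul_neg, ← hparts, inv_mul_cancel_left₀ hk']

theorem isBigO_integral_radialQuotient (hQ : Q.IsSymm) (hdet : Q.det ≠ 0) (N a : ℕ)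
    {f : (Fin n → ℝ) → ℂ} (hf : FlatAtZero f) (hfs : HasCompactSupport f) :
    (fun k : ℝ => ∫ x, radialQuotient a f x * quadPhase Q k x)
      =O[atTop] fun k : ℝ => k ^ (-(N : ℝ)) := by
  induction N generalizing a f with
  | zero =>
    simp only [Nat.cast_zero, neg_zero, Real.rpow_zero]
    refine IsBigO.of_bound (∫ x, ‖radialQuotient a f x‖) (.of_forall fun k => ?_)
    refine (norm_integral_le_integral_norm _).trans_eq ?_
    simp [norm_quadPhase]
  | succ N ih =>
    have hfj (j : Fin n) : FlatAtZero fun y : Fin n → ℝ => y j • f y :=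
      hf.smul (contDiff_apply ℝ ℝ j)
    have hfjs (j : Fin n) : HasCompactSupport fun y : Fin n → ℝ => y j • f y :=
      hfs.smul_left (f := fun y : Fin n → ℝ => y j)
    let v (j : Fin n) : Fin n → ℝ := Q⁻¹ *ᵥ Pi.single j 1
    let F (j : Fin n) := radialQuotientDerivNumerator (a + 1) (fun y => y j • f y) (v j)
    have hF (j : Fin n) : FlatAtZero (F j) := (hfj j).radialQuotientDerivNumerator _ _
    have hFs (j : Fin n) : HasCompactSupport (F j) := hasCompactSupport_radialQuotientDerivNumerator (hfjs j) _ _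
    have key : ∀ k : ℝ, k ≠ 0 → ∫ x, radialQuotient a f x * quadPhase Q k x
        = ∑ j, -(2 * Complex.I * k)⁻¹ * ∫ x, radialQuotient (a + 2) (F j) x * quadPhase Q k x := by
      intro k hk
      simp_rw [radialQuotient_eq_sum hf.apply_zero a, Finset.sum_mul]
      have hcont (j : Fin n) := ((hfj j).differentiable_radialQuotient (a + 1)).continuous
      rw [integral_finsetSum]
      · refine Finset.sum_congr rfl fun j _ => ?_
        exact integral_coord_mul_quadPhase hQ hdet j (hcont j)
          ((hF j).differentiable_radialQuotient _).continuous
          (hasCompactSupport_radialQuotient (hfjs j) _) (hasCompactSupport_radialQuotient (hFs j) _)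
          (fun x => (hfj j).hasLineDerivAt_radialQuotient (a + 1) x _) hk
      · intro j _
        have := hcont j
        have := continuous_quadPhase Q k
        exact Continuous.integrable_of_hasCompactSupport (by fun_prop)
          ((hasCompactSupport_radialQuotient (hfjs j) _).mul_left.mul_right)
    have hk0 : ∀ᶠ k : ℝ in atTop, 0 < k := eventually_gt_atTop 0
    refine IsBigO.congr' (IsBigO.fun_sum (s := Finset.univ) fun j _ => ?_)
      (hk0.mono fun k hk => (key k hk.ne').symm)
      (hk0.mono fun k hk => show k⁻¹ * k ^ (-(N : ℝ)) = _ from ?_)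
    · refine IsBigO.mul (IsBigO.of_bound 1 (.of_forall fun k => ?_)) (ih (a + 2) (hF j) (hFs j))
      simp only [norm_neg, norm_inv, norm_mul, Complex.norm_I, Complex.norm_real,
        RCLike.norm_ofNat, mul_inv, one_mul]
      have : 0 ≤ ‖k‖⁻¹ := by positivity
      linarith
    · rw [← Real.rpow_neg_one, ← Real.rpow_add hk]
      congr 1
      push_cast
      ring

end Phase

/-- If the smooth compactly supported amplitude `g` has vanishing infinite jet at the origin
(all iterated partial derivatives of every order, including `g` itself, vanish at `0`) and
`Q` is a nondegenerate symmetric matrix, then `∫ g(x) e^{ikQ(x,x)} dx = O(k^{-N})` as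
`k → +∞` for every natural number `N`. -/
theorem oscillatory_integral_infinitely_flat_amplitude
    (n : ℕ) (g : (Fin n → ℝ) → ℂ) (hg : ContDiff ℝ (⊤ : ℕ∞) g)
    (hgsupp : HasCompactSupport g)
    (hjet : ∀ m : ℕ, iteratedFDeriv ℝ m g 0 = 0)
    (Q : Matrix (Fin n) (Fin n) ℝ) (hQsymm : Q.IsSymm) (hQdet : Q.det ≠ 0) (N : ℕ) :
    (fun k : ℝ =>
        ∫ x : Fin n → ℝ, g x * Complex.exp (Complex.I * (k : ℂ) * (quadForm n Q x : ℂ)))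
      =O[atTop] fun k : ℝ => k ^ (-(N : ℝ)) := by
  have hflat : FlatAtZero g := ⟨hg, hjet⟩
  simpa [radialQuotient, quadPhase] using
    isBigO_integral_radialQuotient hQsymm hQdet N 0 hflat hgsupp
end
end

section
/- Let R be a commutative ring, M an R-module, n ≥ 1, let x₁,…,xₙ, y₁,…,yₙ ∈ M, and let B be an n×n matrix over R. In the exterior algebra Λ(M), with ι : M → Λ(M) the canonical embedding, one has (Σ_{i,j=1}^{n} B_{ij} · ι(xᵢ)ι(yⱼ))^n = n! · det(B) · ι(x₁)ι(y₁)ι(x₂)ι(y₂)⋯ι(xₙ)ι(yₙ). -/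
/-- An alternating map evaluated at linear combinations of a family scales by the determinant of
the coefficient matrix. -/
theorem AlternatingMap.map_matrix_smul_sum {R M N κ : Type*} [CommRing R] [AddCommGroup M]
    [Module R M] [AddCommGroup N] [Module R N] [Fintype κ] [DecidableEq κ]
    (f : M [⋀^κ]→ₗ[R] N) (y : κ → M) (A : Matrix κ κ R) :
    f (fun i => ∑ j, A i j • y j) = A.det • f y := by
  have key : f.compLinearMap (Fintype.linearCombination R y) =
      (LinearMap.toSpanSingleton R N (f y)).compAlternatingMap Matrix.detRowAlternating := by
    refine Module.Basis.ext_alternating (Pi.basisFun R κ) fun v hv => ?_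
    obtain ⟨σ, rfl⟩ : ∃ σ : Equiv.Perm κ, ⇑σ = v :=
      ⟨Equiv.ofBijective v (Finite.injective_iff_bijective.mp hv), rfl⟩
    have hdet := Matrix.detRowAlternating.map_perm (fun i : κ => (Pi.basisFun R κ) i) σ
    have hone : Matrix.detRowAlternating (fun i : κ => (Pi.basisFun R κ) i) = (1 : R) := by
      rw [← Pi.basisFun_det]
      exact Module.Basis.det_self _
    have hf := f.map_perm y σ
    rw [hone] at hdet
    simp only [Function.comp_def, Pi.basisFun_apply] at hdet hf
    simp [hdet, hf, Fintype.linearCombination_apply_single, Units.smul_def, Int.cast_smul_eq_zsmul]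
  exact DFunLike.congr_fun key A

/-- The binomial expansion of `(a + s) ^ (k + 1)` when `a` squares to zero and commutes
with `s`. -/
theorem Commute.add_pow_succ_of_mul_self_eq_zero {A : Type*} [Ring A] {a s : A}
    (h : Commute a s) (ha : a * a = 0) (k : ℕ) :
    (a + s) ^ (k + 1) = s ^ (k + 1) + (k + 1 : ℕ) • (a * s ^ k) := by
  induction k with
  | zero => simp [add_comm]
  | succ k ih =>
    have hcomm : s * (a * s ^ k) = a * s ^ (k + 1) := by
      rw [← mul_assoc, ← h.eq, mul_assoc, ← pow_succ']
    rw [pow_succ', ih, add_mul, mul_add, mul_add, mul_smul_comm, mul_smul_comm, ← mul_assoc a a,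
      ha, hcomm, ← pow_succ', succ_nsmul _ (k + 1)]
    simp only [zero_mul, smul_zero, add_zero]
    abel

/-- For pairwise commuting elements `q i` of square zero, the `n`-th power of `∑ i, q i` is
`n!` times their product and the next power vanishes. -/
theorem sum_pow_card_of_commute_of_mul_self_eq_zero {A : Type*} [Ring A] {n : ℕ}
    (q : Fin n → A) (hq : ∀ i j, Commute (q i) (q j)) (hsq : ∀ i, q i * q i = 0) :
    (∑ i, q i) ^ n = n.factorial • (List.ofFn q).prod ∧ (∑ i, q i) ^ (n + 1) = 0 := by
  induction n with
  | zero => simp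
  | succ n ih =>
    obtain ⟨hpow, hzero⟩ := ih (fun i => q i.succ) (fun i j => hq _ _) (fun i => hsq _)
    have hcomm : Commute (q 0) (∑ i : Fin n, q i.succ) :=
      Commute.sum_right _ _ _ fun i _ => hq _ _
    rw [Fin.sum_univ_succ, hcomm.add_pow_succ_of_mul_self_eq_zero (hsq 0),
      hcomm.add_pow_succ_of_mul_self_eq_zero (hsq 0)]
    refine ⟨?_, by rw [pow_succ, hzero]; simp⟩
    rw [hzero, hpow, List.ofFn_succ, List.prod_cons, mul_smul_comm, smul_smul, zero_add,
      Nat.factorial_succ]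

namespace ExteriorAlgebra

variable {R M : Type*} [CommRing R] [AddCommGroup M] [Module R M]

theorem ι_mul_ι_eq_neg (u v : M) : ι R u * ι R v = -(ι R v * ι R u) :=
  eq_neg_of_add_eq_zero_left (ι_add_mul_swap u v)

/-- A product of two vectors commutes with every vector. -/
theorem commute_ι_mul_ι_ι (u v w : M) : Commute (ι R u * ι R v) (ι R w) := by
  rw [commute_iff_eq, mul_assoc, ι_mul_ι_eq_neg v w, mul_neg, ← mul_assoc, ι_mul_ι_eq_neg u w,
    neg_mul, neg_neg, mul_assoc]

theorem ι_mul_ι_mul_self (u v : M) : ι R u * ι R v * (ι R u * ι R v) = 0 := by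
  rw [← mul_assoc, (commute_ι_mul_ι_ι u v u).eq, ← mul_assoc, ι_sq_zero, zero_mul, zero_mul]

theorem ι_mul_ιMulti (u : M) {n : ℕ} (v : Fin n → M) :
    ι R u * ιMulti R n v = (-1 : R) ^ n • (ιMulti R n v * ι R u) := by
  induction n with
  | zero => simp
  | succ n ih =>
    rw [ιMulti_succ_apply, ← mul_assoc, ι_mul_ι_eq_neg u, neg_mul, mul_assoc, ih, mul_smul_comm,
      mul_assoc, pow_succ, mul_neg_one, neg_smul]

/-- Separating the two kinds of factors in `∏ i, ι (x i) * ι (z i)`. -/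
theorem prod_ofFn_ι_mul_ι {n : ℕ} (x z : Fin n → M) :
    (List.ofFn fun i => ι R (x i) * ι R (z i)).prod =
      (-1 : R) ^ n.choose 2 • (ιMulti R n x * ιMulti R n z) := by
  induction n with
  | zero => simp
  | succ n ih =>
    have hswap : ι R (z 0) * (ιMulti R n (Matrix.vecTail x) * ιMulti R n (Matrix.vecTail z)) =
        (-1 : R) ^ n •
          (ιMulti R n (Matrix.vecTail x) * (ι R (z 0) * ιMulti R n (Matrix.vecTail z))) := by
      rw [← mul_assoc, ι_mul_ιMulti, smul_mul_assoc, mul_assoc]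
    have htail := ih (Matrix.vecTail x) (Matrix.vecTail z)
    simp only [Matrix.vecTail, Function.comp_apply] at htail
    rw [List.ofFn_succ, List.prod_cons, htail, mul_smul_comm, mul_assoc]
    change _ • (_ * (_ * (ιMulti R n (Matrix.vecTail x) * ιMulti R n (Matrix.vecTail z)))) = _
    rw [hswap, mul_smul_comm, smul_smul, ← pow_add, ιMulti_succ_apply, ιMulti_succ_apply,
      Nat.choose_succ_succ' n 1, Nat.choose_one_right, add_comm (n.choose 2),
      mul_assoc]

end ExteriorAlgebra

/-- **Berezin Gaussian integral over a pair of odd vector spaces.** In the exterior algebra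
`Λ(M)` of an `R`-module `M`, for `x₁,…,xₙ, y₁,…,yₙ ∈ M` and an `n×n` matrix `B` over `R`,
`(Σ_{i,j} B_{ij} ι(xᵢ)ι(yⱼ))^n = n! · det B · ι(x₁)ι(y₁)⋯ι(xₙ)ι(yₙ)`. -/
theorem berezin_determinant
    (R : Type*) [CommRing R] (M : Type*) [AddCommGroup M] [Module R M]
    (n : ℕ) (hn : 1 ≤ n) (x y : Fin n → M) (B : Matrix (Fin n) (Fin n) R) :
    (∑ i : Fin n, ∑ j : Fin n,
        B i j • (ExteriorAlgebra.ι R (x i) * ExteriorAlgebra.ι R (y j))) ^ n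
      = (Nat.factorial n : R) • B.det •
          (List.ofFn fun i : Fin n =>
            ExteriorAlgebra.ι R (x i) * ExteriorAlgebra.ι R (y i)).prod := by
  have hsum : ∀ i, ∑ j, B i j • (ExteriorAlgebra.ι R (x i) * ExteriorAlgebra.ι R (y j)) =
      ExteriorAlgebra.ι R (x i) * ExteriorAlgebra.ι R (∑ j, B i j • y j) := fun i => by
    simp [Finset.mul_sum]
  have hpow := (sum_pow_card_of_commute_of_mul_self_eq_zero
    (fun i => ExteriorAlgebra.ι R (x i) * ExteriorAlgebra.ι R (∑ j, B i j • y j))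
    (fun _ _ => (ExteriorAlgebra.commute_ι_mul_ι_ι _ _ _).mul_right
      (ExteriorAlgebra.commute_ι_mul_ι_ι _ _ _))
    (fun _ => ExteriorAlgebra.ι_mul_ι_mul_self _ _)).1
  simp only [hsum]
  rw [hpow, ExteriorAlgebra.prod_ofFn_ι_mul_ι, ExteriorAlgebra.prod_ofFn_ι_mul_ι,
    AlternatingMap.map_matrix_smul_sum, mul_smul_comm, smul_comm _ B.det, Nat.cast_smul_eq_nsmul]
end

section
/- Let R be a commutative ring, M an R-module, s ≥ 1, let θ₀,…,θ_{2s-1} ∈ M, and let Q be a (2s)×(2s) matrix over R that is antisymmetric with vanishing diagonal: Q_{ji} = -Q_{ij} and Q_{ii} = 0. In the exterior algebra Λ(M), with ι : M → Λ(M) the canonical embedding, one has 2^s · (Σ_{0 ≤ i < j ≤ 2s-1} Q_{ij} · ι(θᵢ)ι(θⱼ))^s = (Σ_{σ ∈ S_{2s}} sgn(σ) ∏_{i=0}^{s-1} Q_{σ(2i), σ(2i+1)}) · ι(θ₀)ι(θ₁)⋯ι(θ_{2s-1}), where the sum is over all permutations σ of {0,…,2s-1}. -/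
theorem Fin.two_mul_lt {s : ℕ} (k : Fin s) : 2 * (k : ℕ) < 2 * s := by
  have := k.isLt
  omega

theorem Fin.two_mul_add_one_lt {s : ℕ} (k : Fin s) : 2 * (k : ℕ) + 1 < 2 * s := by
  have := k.isLt
  omega

/-- A symmetric double sum with vanishing diagonal is twice its strictly upper triangular part. -/
theorem sum_sum_eq_two_nsmul_sum_lt {I A : Type*} [Fintype I] [LinearOrder I] [AddCommMonoid A]
    (a : I → I → A) (hsymm : ∀ i j, a j i = a i j) (hdiag : ∀ i, a i i = 0) :
    ∑ i, ∑ j, a i j = 2 • ∑ i, ∑ j, if i < j then a i j else 0 := by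
  have hsplit : ∀ i j, a i j = (if i < j then a i j else 0) + if j < i then a j i else 0 := by
    intro i j
    rcases lt_trichotomy i j with h | rfl | h
    · simp [h, h.not_gt]
    · simp [hdiag]
    · simp [h, h.not_gt, hsymm]
  calc ∑ i, ∑ j, a i j
      = ∑ i, ∑ j, ((if i < j then a i j else 0) + if j < i then a j i else 0) :=
        Finset.sum_congr rfl fun i _ => Finset.sum_congr rfl fun j _ => hsplit i j
    _ = _ := by
        simp only [Finset.sum_add_distrib, two_nsmul]
        rw [Finset.sum_comm (f := fun i j => if j < i then a j i else 0)]

/-- A sum over tuples of length `n + 2` splits off the first two entries. -/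
theorem sum_tuple_succ_succ {I A : Type*} [Fintype I] [AddCommMonoid A] {n : ℕ}
    (F : (Fin (n + 2) → I) → A) :
    ∑ f, F f = ∑ i, ∑ j, ∑ g : Fin n → I, F (Fin.cons i (Fin.cons j g)) := by
  have hcons : ∀ (m : ℕ) (G : (Fin (m + 1) → I) → A),
      ∑ f, G f = ∑ i, ∑ g : Fin m → I, G (Fin.cons i g) := by
    intro m G
    rw [← (Fin.consEquiv fun _ => I).sum_comp, Fintype.sum_prod_type]
    rfl
  simp only [hcons]

namespace ExteriorAlgebra

variable {R M I : Type*} [CommRing R] [AddCommGroup M] [Module R M] [Fintype I]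

/-- Expansion of a power of a quadratic element of the exterior algebra over tuples of indices. -/
theorem quadratic_pow_eq_sum_ιMulti (Q : I → I → R) (θ : I → M) (s : ℕ) :
    (∑ i, ∑ j, Q i j • (ι R (θ i) * ι R (θ j))) ^ s =
      ∑ f : Fin (2 * s) → I,
        (∏ k : Fin s, Q (f ⟨2 * (k : ℕ), k.two_mul_lt⟩)
          (f ⟨2 * (k : ℕ) + 1, k.two_mul_add_one_lt⟩)) •
          ιMulti R (2 * s) (fun k => θ (f k)) := by
  induction s with
  | zero => simp [ιMulti_apply]
  | succ s ih =>
    rw [pow_succ', ih]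
    refine Eq.trans ?_ (sum_tuple_succ_succ (n := 2 * s) _).symm
    rw [Finset.sum_mul]
    refine Finset.sum_congr rfl fun i _ => ?_
    rw [Finset.sum_mul]
    refine Finset.sum_congr rfl fun j _ => ?_
    rw [Finset.mul_sum]
    refine Finset.sum_congr rfl fun g _ => ?_
    rw [Fin.prod_univ_succ, smul_mul_smul_comm]
    have hmulti : ιMulti R (2 * s + 2)
        (fun k => θ ((Fin.cons i (Fin.cons j g) : Fin (2 * s + 2) → I) k)) =
        ι R (θ i) * ι R (θ j) * ιMulti R (2 * s) (fun k => θ (g k)) := by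
      rw [ιMulti_succ_apply, ιMulti_succ_apply, mul_assoc]
      rfl
    exact congrArg₂ (· • ·) rfl hmulti.symm

/-- The sum over all index tuples of an alternating expression reduces to a sum over
permutations. -/
theorem sum_smul_ιMulti_eq_sum_perm {n : ℕ} (c : (Fin n → Fin n) → R) (θ : Fin n → M) :
    ∑ f : Fin n → Fin n, c f • ιMulti R n (fun k => θ (f k)) =
      (∑ σ : Equiv.Perm (Fin n), ((Equiv.Perm.sign σ : ℤ) : R) * c σ) • ιMulti R n θ := by
  rw [Finset.sum_smul]
  symm
  refine Fintype.sum_of_injective (fun σ : Equiv.Perm (Fin n) => (σ : Fin n → Fin n))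
    DFunLike.coe_injective _ _ ?_ ?_
  · intro f hf
    have hninj : ¬ Function.Injective f := fun h =>
      hf ⟨Equiv.ofBijective f (Finite.injective_iff_bijective.mp h), rfl⟩
    have hzero : ιMulti R n (fun k => θ (f k)) = 0 :=
      ιMulti_eq_zero_of_not_inj fun h => hninj (Function.Injective.of_comp (f := θ) h)
    rw [hzero, smul_zero]
  · intro σ
    have hperm := (ιMulti R n).map_perm θ σ
    rw [show (fun k => θ (σ k)) = θ ∘ σ from rfl, hperm, Units.smul_def,
      ← Int.cast_smul_eq_zsmul R, smul_smul, mul_comm]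

end ExteriorAlgebra

/-- **Berezin Gaussian integral / Pfaffian identity** (denominator-free form). In the exterior
algebra `Λ(M)`, for `θ₀,…,θ_{2s-1} ∈ M` and a `(2s)×(2s)` antisymmetric matrix `Q` over `R`
with vanishing diagonal,
`2^s (Σ_{i<j} Q_{ij} ι(θᵢ)ι(θⱼ))^s
  = (Σ_{σ ∈ S_{2s}} sgn σ Π_{i=0}^{s-1} Q_{σ(2i) σ(2i+1)}) · ι(θ₀)⋯ι(θ_{2s-1})`. -/
theorem berezin_pfaffian
    (R : Type*) [CommRing R] (M : Type*) [AddCommGroup M] [Module R M]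
    (s : ℕ) (hs : 1 ≤ s) (θ : Fin (2 * s) → M)
    (Q : Matrix (Fin (2 * s)) (Fin (2 * s)) R)
    (hanti : ∀ i j, Q j i = - Q i j) (hdiag : ∀ i, Q i i = 0) :
    (2 ^ s : R) •
        (∑ i : Fin (2 * s), ∑ j : Fin (2 * s),
          if i < j then Q i j • (ExteriorAlgebra.ι R (θ i) * ExteriorAlgebra.ι R (θ j))
          else 0) ^ s
      = (∑ σ : Equiv.Perm (Fin (2 * s)),
            ((Equiv.Perm.sign σ : ℤ) : R) *
              ∏ i : Fin s,
                Q (σ ⟨2 * (i : ℕ), by have := i.isLt; omega⟩)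
                  (σ ⟨2 * (i : ℕ) + 1, by have := i.isLt; omega⟩)) •
          (List.ofFn fun i : Fin (2 * s) => ExteriorAlgebra.ι R (θ i)).prod := by
  have hdouble := sum_sum_eq_two_nsmul_sum_lt
    (fun i j => Q i j • (ExteriorAlgebra.ι R (θ i) * ExteriorAlgebra.ι R (θ j)))
    (fun i j => by
      rw [hanti i j, eq_neg_of_add_eq_zero_left (ExteriorAlgebra.ι_add_mul_swap (θ j) (θ i)),
        neg_smul_neg])
    (fun i => by rw [hdiag, zero_smul])
  rw [← Nat.cast_smul_eq_nsmul R, Nat.cast_ofNat] at hdouble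
  rw [← smul_pow, ← hdouble, ← ExteriorAlgebra.ιMulti_apply]
  exact (ExteriorAlgebra.quadratic_pow_eq_sum_ιMulti Q θ s).trans <|
    ExteriorAlgebra.sum_smul_ιMulti_eq_sum_perm
      (fun f => ∏ i : Fin s, Q (f ⟨2 * (i : ℕ), i.two_mul_lt⟩)
        (f ⟨2 * (i : ℕ) + 1, i.two_mul_add_one_lt⟩)) θ
end

section
/- Let R be a commutative ring, and let (V^•, d) and (V'^•, d') be cochain complexes of R-modules (so d∘d = 0 and d'∘d' = 0). Suppose ι : V'^• → V^• and p : V^• → V'^• are chain maps with p∘ι = id_{V'}, and suppose there exists a degree -1 map h : V^• → V^{•-1} with d h + h d = id_V - ι∘p. Then there exists a degree -1 map K : V^• → V^{•-1} satisfying all four conditions: d K + K d = id_V - ι∘p, K∘ι = 0, p∘K = 0, and K∘K = 0. -/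
/-- Conjugating a contracting homotopy by the projector `id - ι ∘ p` yields a homotopy which
vanishes on the image of `ι` and takes values in the kernel of `p`. -/
theorem exists_homotopy_comp_eq_zero
    {R : Type*} [CommRing R]
    {V V' : ℤ → Type*} [∀ k, AddCommGroup (V k)] [∀ k, Module R (V k)]
    [∀ k, AddCommGroup (V' k)] [∀ k, Module R (V' k)]
    (d : ∀ k, V k →ₗ[R] V (k + 1)) (d' : ∀ k, V' k →ₗ[R] V' (k + 1))
    (ι : ∀ k, V' k →ₗ[R] V k) (p : ∀ k, V k →ₗ[R] V' k)
    (hι : ∀ k, (d k).comp (ι k) = (ι (k + 1)).comp (d' k))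
    (hp : ∀ k, (d' k).comp (p k) = (p (k + 1)).comp (d k))
    (hpι : ∀ k, (p k).comp (ι k) = LinearMap.id)
    (h : ∀ k, V (k + 1) →ₗ[R] V k)
    (hh : ∀ k, (d k).comp (h k) + (h (k + 1)).comp (d (k + 1))
        = LinearMap.id - (ι (k + 1)).comp (p (k + 1))) :
    ∃ K : ∀ k, V (k + 1) →ₗ[R] V k,
      (∀ k, (d k).comp (K k) + (K (k + 1)).comp (d (k + 1))
          = LinearMap.id - (ι (k + 1)).comp (p (k + 1))) ∧
      (∀ k, (K k).comp (ι (k + 1)) = 0) ∧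
      (∀ k, (p k).comp (K k) = 0) := by
  let q : ∀ k, V k →ₗ[R] V k := fun k => LinearMap.id - (ι k).comp (p k)
  have hqι (k) : (q k).comp (ι k) = 0 := by
    rw [LinearMap.sub_comp, LinearMap.comp_assoc, hpι, LinearMap.id_comp, LinearMap.comp_id,
      sub_self]
  have hpq (k) : (p k).comp (q k) = 0 := by
    rw [LinearMap.comp_sub, ← LinearMap.comp_assoc, hpι, LinearMap.id_comp, LinearMap.comp_id,
      sub_self]
  have hqq (k) : (q k).comp (q k) = q k := by
    conv_lhs => enter [1]; change LinearMap.id - (ι k).comp (p k)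
    rw [LinearMap.sub_comp, LinearMap.comp_assoc, hpq, LinearMap.comp_zero, LinearMap.id_comp,
      sub_zero]
  have hdq (k) : (d k).comp (q k) = (q (k + 1)).comp (d k) := by
    rw [LinearMap.comp_sub, LinearMap.sub_comp, ← LinearMap.comp_assoc, hι, LinearMap.comp_assoc,
      LinearMap.comp_assoc, hp, LinearMap.comp_id, LinearMap.id_comp]
  refine ⟨fun k => (q k).comp ((h k).comp (q (k + 1))), fun k => ?_, fun k => ?_, fun k => ?_⟩
  · calc
      _ = (q (k + 1)).comp (((d k).comp (h k) + (h (k + 1)).comp (d (k + 1))).comp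
            (q (k + 1))) := by
        rw [LinearMap.add_comp, LinearMap.comp_add, ← LinearMap.comp_assoc, hdq]
        simp only [LinearMap.comp_assoc, hdq]
      _ = q (k + 1) := by
        rw [hh]
        change (q (k + 1)).comp ((q (k + 1)).comp (q (k + 1))) = _
        rw [hqq, hqq]
  · rw [LinearMap.comp_assoc, LinearMap.comp_assoc, hqι, LinearMap.comp_zero, LinearMap.comp_zero]
  · rw [← LinearMap.comp_assoc, hpq, LinearMap.zero_comp]

/-- If `h` is a contracting homotopy with `h ∘ ι = 0` and `p ∘ h = 0`, then `h ∘ d ∘ h` is a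
contracting homotopy which moreover squares to zero. -/
theorem homotopy_comp_differential_comp_homotopy
    {R : Type*} [CommRing R]
    {V V' : ℤ → Type*} [∀ k, AddCommGroup (V k)] [∀ k, Module R (V k)]
    [∀ k, AddCommGroup (V' k)] [∀ k, Module R (V' k)]
    (d : ∀ k, V k →ₗ[R] V (k + 1)) (hd : ∀ k, (d (k + 1)).comp (d k) = 0)
    (ι : ∀ k, V' k →ₗ[R] V k) (p : ∀ k, V k →ₗ[R] V' k)
    (h : ∀ k, V (k + 1) →ₗ[R] V k)
    (hh : ∀ k, (d k).comp (h k) + (h (k + 1)).comp (d (k + 1))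
        = LinearMap.id - (ι (k + 1)).comp (p (k + 1)))
    (hhι : ∀ k, (h k).comp (ι (k + 1)) = 0) (hph : ∀ k, (p k).comp (h k) = 0) :
    (∀ k, (d k).comp ((h k).comp ((d k).comp (h k)))
        + ((h (k + 1)).comp ((d (k + 1)).comp (h (k + 1)))).comp (d (k + 1))
          = LinearMap.id - (ι (k + 1)).comp (p (k + 1))) ∧
      ∀ k, ((h k).comp ((d k).comp (h k))).comp
        ((h (k + 1)).comp ((d (k + 1)).comp (h (k + 1)))) = 0 := by
  have hh_apply (k x) : d k (h k x) + h (k + 1) (d (k + 1) x) = x - ι (k + 1) (p (k + 1) x) :=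
    LinearMap.congr_fun (hh k) x
  have hd_apply (k x) : d (k + 1) (d k x) = 0 := LinearMap.congr_fun (hd k) x
  have hhι_apply (k x) : h k (ι (k + 1) x) = 0 := LinearMap.congr_fun (hhι k) x
  have hph_apply (k x) : p k (h k x) = 0 := LinearMap.congr_fun (hph k) x
  have hhdh (k x) : h k (d k (h k x)) = h k x - h k (h (k + 1) (d (k + 1) x)) := by
    rw [eq_sub_of_add_eq (hh_apply k x), map_sub, map_sub, hhι_apply, sub_zero]
  have hdhhd (k x) : d k (h k (h (k + 1) (d (k + 1) x))) = 0 := by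
    have key := hh_apply k (h (k + 1) (d (k + 1) x))
    rw [hph_apply, map_zero, sub_zero, hhdh, hd_apply, map_zero, map_zero, sub_zero] at key
    exact add_eq_right.mp key
  refine ⟨fun k => LinearMap.ext fun x => ?_, fun k => LinearMap.ext fun x => ?_⟩
  · simp only [LinearMap.add_apply, LinearMap.comp_apply, LinearMap.sub_apply, LinearMap.id_apply]
    rw [hhdh, hhdh, hd_apply, map_zero, map_zero, sub_zero, map_sub, hdhhd, sub_zero, hh_apply]
  · simp only [LinearMap.comp_apply, LinearMap.zero_apply]
    rw [hdhhd, map_zero]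

/-- **Existence of induction (HPT) data.** Given cochain complexes `(V,d)` and `(V',d')` of
`R`-modules, chain maps `ι : V' → V`, `p : V → V'` with `p∘ι = id`, and a chain homotopy `h`
with `dh + hd = id - ι∘p`, there exists a degree `-1` map `K` satisfying simultaneously
`dK + Kd = id - ι∘p`, `K∘ι = 0`, `p∘K = 0` and `K∘K = 0`.

(Here degree `-1` maps are encoded as families `∀ k, V (k+1) →ₗ[R] V k`, and all the
identities are stated at every degree, the degree-`k+1` instance being indexed by `k : ℤ`.) -/
theorem exists_induction_data
    (R : Type*) [CommRing R]
    (V V' : ℤ → Type*) [∀ k, AddCommGroup (V k)] [∀ k, Module R (V k)]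
    [∀ k, AddCommGroup (V' k)] [∀ k, Module R (V' k)]
    (d : ∀ k, V k →ₗ[R] V (k + 1)) (d' : ∀ k, V' k →ₗ[R] V' (k + 1))
    (hd : ∀ k, (d (k + 1)).comp (d k) = 0) (hd' : ∀ k, (d' (k + 1)).comp (d' k) = 0)
    (ι : ∀ k, V' k →ₗ[R] V k) (p : ∀ k, V k →ₗ[R] V' k)
    (hι : ∀ k, (d k).comp (ι k) = (ι (k + 1)).comp (d' k))
    (hp : ∀ k, (d' k).comp (p k) = (p (k + 1)).comp (d k))
    (hpι : ∀ k, (p k).comp (ι k) = LinearMap.id)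
    (h : ∀ k, V (k + 1) →ₗ[R] V k)
    (hh : ∀ k, (d k).comp (h k) + (h (k + 1)).comp (d (k + 1))
        = LinearMap.id - (ι (k + 1)).comp (p (k + 1))) :
    ∃ K : ∀ k, V (k + 1) →ₗ[R] V k,
      (∀ k, (d k).comp (K k) + (K (k + 1)).comp (d (k + 1))
          = LinearMap.id - (ι (k + 1)).comp (p (k + 1))) ∧
      (∀ k, (K k).comp (ι (k + 1)) = 0) ∧
      (∀ k, (p k).comp (K k) = 0) ∧
      (∀ k, (K k).comp (K (k + 1)) = 0) := by
  obtain ⟨g, hg, hgι, hpg⟩ := exists_homotopy_comp_eq_zero d d' ι p hι hp hpι h hh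
  obtain ⟨hK, hKK⟩ := homotopy_comp_differential_comp_homotopy d hd ι p g hg hgι hpg
  refine ⟨fun k => (g k).comp ((d k).comp (g k)), hK, fun k => ?_, fun k => ?_, hKK⟩
  · rw [LinearMap.comp_assoc, LinearMap.comp_assoc, hgι, LinearMap.comp_zero, LinearMap.comp_zero]
  · rw [← LinearMap.comp_assoc, hpg, LinearMap.zero_comp]
end

section
/- For every natural number N, as ν → 0⁺ one has ∫_ℝ e^{-x²/2 - ν x⁴/24} dx = √(2π) · Σ_{n=0}^{N-1} (-ν)ⁿ · (4n-1)!! / (n! · 24ⁿ) + O(ν^N); that is, the formal Feynman series √(2π) Σ_{n≥0} λⁿ (4n-1)!!/(n!·4!ⁿ) with λ = -ν is the Poincaré asymptotic series of the convergent quartic-perturbed Gaussian integral at ν → 0⁺. -/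
open MeasureTheory Filter Asymptotics

/-- The Taylor polynomial of `exp` of degree `< N` approximates `exp` on the negative half-line
up to the first omitted term. -/
lemma abs_exp_neg_sub_sum_le {t : ℝ} (ht : 0 ≤ t) (N : ℕ) :
    |Real.exp (-t) - ∑ n ∈ Finset.range N, (-t) ^ n / (n.factorial : ℝ)| ≤
      t ^ N / (N.factorial : ℝ) := by
  rcases N with _ | N
  · simpa using ht
  rcases ht.eq_or_lt with rfl | ht
  · simp [Finset.sum_range_succ']
  have hne : (0 : ℝ) ≠ -t := by linarith
  obtain ⟨y, hy, h⟩ := taylor_mean_remainder_lagrange_iteratedDeriv (n := N) hne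
    Real.contDiff_exp.contDiffOn
  have hsum : taylorWithinEval Real.exp N (Set.uIcc 0 (-t)) 0 (-t) =
      ∑ n ∈ Finset.range (N + 1), (-t) ^ n / (n.factorial : ℝ) := by
    rw [taylor_within_apply]
    refine Finset.sum_congr rfl fun n _ => ?_
    rw [iteratedDerivWithin_eq_iteratedDeriv (uniqueDiffOn_uIcc hne)
      Real.contDiff_exp.contDiffAt Set.left_mem_uIcc, iteratedDeriv_eq_iterate,
      Real.iter_deriv_exp]
    simp [div_eq_inv_mul]
  rw [hsum, iteratedDeriv_eq_iterate, Real.iter_deriv_exp, sub_zero] at h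
  have hy0 : y ≤ 0 := by
    have := hy.2
    rw [max_eq_left (by linarith)] at this
    exact this.le
  rw [h, abs_div, abs_mul, abs_pow, abs_neg, abs_of_pos ht, Real.abs_exp, Nat.abs_cast]
  gcongr
  exact mul_le_of_le_one_left (by positivity) (Real.exp_le_one_iff.mpr hy0)

lemma integrable_pow_mul_exp_neg_sq_div_two (k : ℕ) :
    Integrable fun x : ℝ => x ^ k * Real.exp (-(x ^ 2) / 2) := by
  have h := integrable_rpow_mul_exp_neg_mul_sq (b := 1 / 2) (by norm_num) (s := k)
    (by linarith [(Nat.cast_nonneg k : (0 : ℝ) ≤ k)])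
  refine h.congr (.of_forall fun x => ?_)
  simp only [Real.rpow_natCast]
  ring_nf

/-- The even moments of the (unnormalised) standard Gaussian. -/
lemma integral_pow_two_mul_mul_exp_neg_sq_div_two (k : ℕ) :
    ∫ x : ℝ, x ^ (2 * k) * Real.exp (-(x ^ 2) / 2) =
      √(2 * Real.pi) * (Nat.doubleFactorial (2 * k - 1) : ℝ) := by
  have habs := integral_comp_abs (f := fun x : ℝ => x ^ (2 * k) * Real.exp (-(x ^ 2) / 2))
  simp only [pow_mul, sq_abs] at habs
  have hgamma := integral_rpow_mul_exp_neg_mul_rpow (p := 2) (q := (2 * k : ℕ)) (b := 1 / 2)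
    (by norm_num) (by linarith [(Nat.cast_nonneg (2 * k) : (0 : ℝ) ≤ (2 * k : ℕ))]) (by norm_num)
  have hcongr : ∫ x in Set.Ioi (0 : ℝ), (x ^ 2) ^ k * Real.exp (-(x ^ 2) / 2) =
      ∫ x in Set.Ioi (0 : ℝ), x ^ ((2 * k : ℕ) : ℝ) * Real.exp (-(1 / 2) * x ^ (2 : ℝ)) := by
    refine integral_congr_ae (.of_forall fun x => ?_)
    simp only [Real.rpow_natCast, Real.rpow_ofNat, pow_mul]
    ring_nf
  have hexp : (((2 * k : ℕ) : ℝ) + 1) / 2 = k + 1 / 2 := by push_cast; ring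
  have hpow : (1 / 2 : ℝ) ^ (-((k : ℝ) + 1 / 2)) = 2 ^ k * √2 := by
    rw [one_div, Real.inv_rpow (by norm_num), Real.rpow_neg (by norm_num), inv_inv,
      Real.rpow_add (by norm_num), Real.rpow_natCast, ← one_div, ← Real.sqrt_eq_rpow]
  rw [neg_div, hexp, hpow, Real.Gamma_nat_add_half] at hgamma
  simp only [pow_mul]
  rw [habs, hcongr, hgamma, Real.sqrt_mul (by norm_num)]
  field_simp

/-- The formal Feynman series `√(2π) Σ_{n≥0} λⁿ (4n-1)!!/(n!·4!ⁿ)` with `λ = -ν` is the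
Poincaré asymptotic series at `ν → 0⁺` of the quartic-perturbed Gaussian integral: for
every `N`, `∫ e^{-x²/2 - νx⁴/24} dx = √(2π) Σ_{n=0}^{N-1} (-ν)ⁿ (4n-1)!!/(n!·24ⁿ) + O(ν^N)`. -/
theorem quartic_perturbed_gaussian_asymptotics (N : ℕ) :
    (fun ν : ℝ =>
        (∫ x : ℝ, Real.exp (-(x ^ 2) / 2 - ν * x ^ 4 / 24)) -
          Real.sqrt (2 * Real.pi) *
            ∑ n ∈ Finset.range N,
              (-ν) ^ n * (Nat.doubleFactorial (4 * n - 1) : ℝ) /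
                ((Nat.factorial n : ℝ) * 24 ^ n))
      =O[nhdsWithin (0 : ℝ) (Set.Ioi 0)] fun ν : ℝ => ν ^ N := by
  set M : ℕ → ℝ := fun n => ∫ x : ℝ, x ^ (4 * n) * Real.exp (-(x ^ 2) / 2)
  have hmoment (n : ℕ) : M n = √(2 * Real.pi) * (Nat.doubleFactorial (4 * n - 1) : ℝ) := by
    have := integral_pow_two_mul_mul_exp_neg_sq_div_two (2 * n)
    rwa [← mul_assoc] at this
  have hint (c : ℝ) (n : ℕ) :
      Integrable fun x : ℝ => c * (x ^ (4 * n) * Real.exp (-(x ^ 2) / 2)) :=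
    (integrable_pow_mul_exp_neg_sq_div_two (4 * n)).const_mul c
  refine IsBigO.of_bound (M N / ((N.factorial : ℝ) * 24 ^ N)) ?_
  filter_upwards [self_mem_nhdsWithin] with ν (hν : 0 < ν)
  have hsum : √(2 * Real.pi) * ∑ n ∈ Finset.range N,
      (-ν) ^ n * (Nat.doubleFactorial (4 * n - 1) : ℝ) / ((n.factorial : ℝ) * 24 ^ n) =
      ∫ x : ℝ, ∑ n ∈ Finset.range N, (-ν) ^ n / ((n.factorial : ℝ) * 24 ^ n) *
        (x ^ (4 * n) * Real.exp (-(x ^ 2) / 2)) := by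
    rw [integral_finsetSum _ fun n _ => hint _ n, Finset.mul_sum]
    refine Finset.sum_congr rfl fun n _ => ?_
    rw [integral_const_mul,
      show ∫ x : ℝ, x ^ (4 * n) * Real.exp (-(x ^ 2) / 2) = _ from hmoment n]
    ring
  have hfull : Integrable fun x : ℝ => Real.exp (-(x ^ 2) / 2 - ν * x ^ 4 / 24) := by
    refine (hint 1 0).mono' (by fun_prop) (.of_forall fun x => ?_)
    rw [Real.norm_eq_abs, Real.abs_exp, mul_zero, pow_zero, one_mul, one_mul]
    have : 0 ≤ ν * x ^ 4 / 24 := by positivity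
    gcongr
    linarith
  rw [hsum, ← integral_sub hfull (integrable_finsetSum _ fun n _ => hint _ n)]
  have hbound : ‖ν ^ N‖ = ν ^ N := Real.norm_of_nonneg (by positivity)
  calc _ ≤ ∫ x : ℝ, ν ^ N / ((N.factorial : ℝ) * 24 ^ N) *
        (x ^ (4 * N) * Real.exp (-(x ^ 2) / 2)) := by
        refine norm_integral_le_of_norm_le (hint _ N) (.of_forall fun x => ?_)
        have hfactor : Real.exp (-(x ^ 2) / 2 - ν * x ^ 4 / 24) -
            ∑ n ∈ Finset.range N, (-ν) ^ n / ((n.factorial : ℝ) * 24 ^ n) *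
              (x ^ (4 * n) * Real.exp (-(x ^ 2) / 2)) =
            (Real.exp (-(ν * x ^ 4 / 24)) -
              ∑ n ∈ Finset.range N, (-(ν * x ^ 4 / 24)) ^ n / (n.factorial : ℝ)) *
              Real.exp (-(x ^ 2) / 2) := by
          rw [sub_mul, ← Real.exp_add, Finset.sum_mul, neg_add_eq_sub]
          congr 1
          refine Finset.sum_congr rfl fun n _ => ?_
          rw [show -(ν * x ^ 4 / 24) = -ν * x ^ 4 / 24 by ring, div_pow, mul_pow, ← pow_mul]
          field_simp
        rw [hfactor, Real.norm_eq_abs, abs_mul, Real.abs_exp]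
        calc _ ≤ (ν * x ^ 4 / 24) ^ N / (N.factorial : ℝ) * Real.exp (-(x ^ 2) / 2) := by
              gcongr
              exact abs_exp_neg_sub_sum_le (by positivity) N
          _ = _ := by
              rw [div_pow, mul_pow, ← pow_mul]
              field_simp
    _ = _ := by
        rw [integral_const_mul, hbound]
        ring
end
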